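/- arXiv:2407.16195 — 4 statements merged into one kernel-verified Lean document; each statement's English description precedes it below -/
import Mathlib

section
/- Let R_1 = ((max_{x∈[0,L]} ρ(x) + m)/(min_{x∈[0,L]} EI(x)))·max{1, L}. Then for every integer k ≥ 1 and every x ∈ [0,L], the generating function g_k satisfies |g_k(x)| ≤ R_1^k x^{4k−1}/(4k−1)! and |g_k'(x)| ≤ R_1^k x^{4k−2}/(4k−2)!. -/
open Set Filter intervalIntegral

/-- The generating functions `g_k` of the beam model, defined by iterated integrals. -/
noncomputable def genG (ρ EI : ℝ → ℝ) (m : ℝ) : ℕ → ℝ → ℝ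
  | 0 => fun _ => 1
  | 1 => fun x =>
      -(∫ s₁ in (0:ℝ)..x, ∫ s₂ in (0:ℝ)..s₁, ∫ s₃ in (0:ℝ)..s₂, ∫ s₄ in (0:ℝ)..s₃,
          ρ s₄ / EI s₂)
      - m * ∫ s₁ in (0:ℝ)..x, ∫ s₂ in (0:ℝ)..s₁, ∫ _s₃ in (0:ℝ)..s₂, 1 / EI s₂
  | (k + 2) => fun x =>
      -(∫ s₁ in (0:ℝ)..x, ∫ s₂ in (0:ℝ)..s₁, ∫ s₃ in (0:ℝ)..s₂, ∫ s₄ in (0:ℝ)..s₃,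
          ρ s₄ * genG ρ EI m (k + 1) s₄ / EI s₂)

/-- The generating functions `h_k` of the beam model, defined by iterated integrals. -/
noncomputable def genH (ρ EI : ℝ → ℝ) (J : ℝ) : ℕ → ℝ → ℝ
  | 0 => fun x => x
  | 1 => fun x =>
      -(∫ s₁ in (0:ℝ)..x, ∫ s₂ in (0:ℝ)..s₁, ∫ s₃ in (0:ℝ)..s₂, ∫ s₄ in (0:ℝ)..s₃,
          s₄ * ρ s₄ / EI s₂)
      + J * ∫ s₁ in (0:ℝ)..x, ∫ s₂ in (0:ℝ)..s₁, 1 / EI s₂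
  | (k + 2) => fun x =>
      -(∫ s₁ in (0:ℝ)..x, ∫ s₂ in (0:ℝ)..s₁, ∫ s₃ in (0:ℝ)..s₂, ∫ s₄ in (0:ℝ)..s₃,
          ρ s₄ * genH ρ EI J (k + 1) s₄ / EI s₂)

/-- Membership in the Gevrey class `G_s[0,T]`: a smooth function whose derivatives satisfy
`sup_{t ∈ [0,T]} |y⁽ᵐ⁾(t)| ≤ D^(m+1) (m!)^s` for some `D > 0`. -/
def MemGevrey (s T : ℝ) (y : ℝ → ℝ) : Prop :=
  ContDiff ℝ (⊤ : ℕ∞) y ∧ ∃ D > 0, ∀ (n : ℕ), ∀ t ∈ Set.Icc (0:ℝ) T,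
    |iteratedDeriv n y t| ≤ D ^ (n + 1) * (n.factorial : ℝ) ^ s

/-- Primitive from 0. -/
noncomputable def primZ (f : ℝ → ℝ) (x : ℝ) : ℝ := ∫ s in (0:ℝ)..x, f s

lemma primZ_deriv {L : ℝ} {f : ℝ → ℝ} (hf : ContinuousOn f (Set.Icc 0 L)) {x : ℝ}
    (hx : x ∈ Set.Icc (0:ℝ) L) : HasDerivWithinAt (primZ f) (f x) (Set.Icc 0 L) x := by
  have : Fact (x ∈ Set.Icc (0:ℝ) L) := ⟨hx⟩
  have hint : IntervalIntegrable f MeasureTheory.volume 0 x := by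
    apply ContinuousOn.intervalIntegrable
    rw [Set.uIcc_of_le hx.1]
    exact hf.mono (Set.Icc_subset_Icc_right hx.2)
  exact intervalIntegral.integral_hasDerivWithinAt_right hint
    (hf.stronglyMeasurableAtFilter_nhdsWithin measurableSet_Icc x) (hf x hx)

lemma primZ_cont {L : ℝ} {f : ℝ → ℝ} (hf : ContinuousOn f (Set.Icc 0 L)) :
    ContinuousOn (primZ f) (Set.Icc 0 L) :=
  fun _ hx => (primZ_deriv hf hx).continuousWithinAt

lemma primZ_bound {L A : ℝ} {n : ℕ} {f : ℝ → ℝ}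
    (hb : ∀ s ∈ Set.Icc (0:ℝ) L, |f s| ≤ A * s ^ n / (n.factorial : ℝ)) :
    ∀ x ∈ Set.Icc (0:ℝ) L, |primZ f x| ≤ A * x ^ (n + 1) / ((n + 1).factorial : ℝ) := by
  intro x hx
  have h1 : ‖∫ s in (0:ℝ)..x, f s‖ ≤ ∫ s in (0:ℝ)..x, A * s ^ n / (n.factorial : ℝ) := by
    apply intervalIntegral.norm_integral_le_of_norm_le hx.1
    · exact Filter.Eventually.of_forall fun t ht => hb t ⟨ht.1.le, ht.2.trans hx.2⟩
    · exact Continuous.intervalIntegrable (by fun_prop) _ _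
  have h2 : (∫ s in (0:ℝ)..x, A * s ^ n / (n.factorial : ℝ))
      = A * x ^ (n + 1) / ((n + 1).factorial : ℝ) := by
    rw [intervalIntegral.integral_div, intervalIntegral.integral_const_mul, integral_pow,
      Nat.factorial_succ]
    have : (n.factorial : ℝ) ≠ 0 := by positivity
    push_cast
    field_simp
    simp
  rw [h2] at h1
  exact h1

lemma div_bound {L A e : ℝ} {n : ℕ} {f E : ℝ → ℝ} (he : 0 < e)
    (hE : ∀ s ∈ Set.Icc (0:ℝ) L, e ≤ E s)
    (hb : ∀ s ∈ Set.Icc (0:ℝ) L, |f s| ≤ A * s ^ n / (n.factorial : ℝ)) :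
    ∀ s ∈ Set.Icc (0:ℝ) L, |f s / E s| ≤ A / e * s ^ n / (n.factorial : ℝ) := by
  intro s hs
  have h1 := hE s hs
  rw [abs_div, abs_of_pos (he.trans_le h1)]
  calc |f s| / E s ≤ (A * s ^ n / (n.factorial : ℝ)) / e := by
        have := (abs_nonneg _).trans (hb s hs)
        have := hb s hs
        gcongr
    _ = _ := by field_simp

lemma quad_eq (f E : ℝ → ℝ) (x : ℝ) :
    (∫ s₁ in (0:ℝ)..x, ∫ s₂ in (0:ℝ)..s₁, ∫ s₃ in (0:ℝ)..s₂, ∫ s₄ in (0:ℝ)..s₃, f s₄ / E s₂)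
      = primZ (primZ (fun s => primZ (primZ f) s / E s)) x := by
  simp only [primZ, intervalIntegral.integral_div]

lemma trip_eq (E : ℝ → ℝ) (x : ℝ) :
    (∫ s₁ in (0:ℝ)..x, ∫ s₂ in (0:ℝ)..s₁, ∫ _s₃ in (0:ℝ)..s₂, 1 / E s₂)
      = primZ (primZ (fun s => s / E s)) x := by
  simp only [primZ, intervalIntegral.integral_div]
  simp

lemma genG_key {L m M e R : ℝ} (hm : 0 < m) (hM : 0 < M) (he : 0 < e)
    {ρ EI : ℝ → ℝ} (hρc : ContinuousOn ρ (Set.Icc 0 L)) (hEc : ContinuousOn EI (Set.Icc 0 L))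
    (hρ : ∀ x ∈ Set.Icc (0:ℝ) L, |ρ x| ≤ M) (hE : ∀ x ∈ Set.Icc (0:ℝ) L, e ≤ EI x)
    (hR : R = (M + m) / e * max 1 L) (k : ℕ) :
    ∃ G : ℝ → ℝ, ∀ x ∈ Set.Icc (0:ℝ) L,
      HasDerivWithinAt (genG ρ EI m (k + 1)) (G x) (Set.Icc 0 L) x ∧
      |genG ρ EI m (k + 1) x| ≤ R ^ (k + 1) * x ^ (4 * k + 3) / ((4 * k + 3).factorial : ℝ) ∧
      |G x| ≤ R ^ (k + 1) * x ^ (4 * k + 2) / ((4 * k + 2).factorial : ℝ) := by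
  have hE0 : ∀ x ∈ Set.Icc (0:ℝ) L, EI x ≠ 0 := fun x hx => (he.trans_le (hE x hx)).ne'
  have h_max : (1:ℝ) ≤ max 1 L := le_max_left _ _
  have hR0 : 0 ≤ R := by rw [hR]; positivity
  induction k with
  | zero =>
    set q1 : ℝ → ℝ := fun s => primZ (primZ ρ) s / EI s with hq1
    set q2 : ℝ → ℝ := fun s => s / EI s with hq2
    have hg : genG ρ EI m (0 + 1) = fun x => -primZ (primZ q1) x - m * primZ (primZ q2) x := by
      funext x
      rw [← quad_eq, ← trip_eq]
      simp [genG]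
    have c1 : ContinuousOn q1 (Set.Icc 0 L) := (primZ_cont (primZ_cont hρc)).div hEc hE0
    have c2 : ContinuousOn q2 (Set.Icc 0 L) := continuousOn_id.div hEc hE0
    have b1 := div_bound (n := 2) he hE (primZ_bound (primZ_bound (n := 0) (A := M) (f := ρ)
      (by simpa using hρ)))
    have b2 := div_bound (n := 1) (A := 1) (f := fun s => s) he hE
      (by intro s hs; simp [abs_of_nonneg hs.1])
    have bound_one_a := primZ_bound b1
    have bound_one_b := primZ_bound bound_one_a
    have bound_two_a := primZ_bound b2
    have bound_two_b := primZ_bound bound_two_a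
    refine ⟨fun x => -primZ q1 x - m * primZ q2 x, fun x hx => ⟨?_, ?_, ?_⟩⟩
    · rw [hg]
      exact (primZ_deriv (primZ_cont c1) hx).neg.sub
        ((primZ_deriv (primZ_cont c2) hx).const_mul m)
    · have i1 := bound_one_b x hx
      have i2 := bound_two_b x hx
      have hx0 := hx.1
      have hxL : x ≤ max 1 L := hx.2.trans (le_max_right _ _)
      rw [hg]
      calc |-primZ (primZ q1) x - m * primZ (primZ q2) x|
          ≤ |primZ (primZ q1) x| + m * |primZ (primZ q2) x| := by
            refine (abs_sub _ _).trans ?_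
            rw [abs_neg, abs_mul, abs_of_pos hm]
        _ ≤ M / e * x ^ 4 / 24 + m * (1 / e * x ^ 3 / 6) := by
            refine add_le_add (i1.trans_eq ?_) (mul_le_mul_of_nonneg_left (i2.trans_eq ?_) hm.le)
            <;> norm_num [Nat.factorial]
        _ ≤ M / e * x ^ 3 / 6 * max 1 L + m / e * x ^ 3 / 6 * max 1 L := by
            refine add_le_add ?_ ?_
            · calc M / e * x ^ 4 / 24 = (M / e * x ^ 3 / 6 * x) / 4 := by ring
                _ ≤ M / e * x ^ 3 / 6 * x := div_le_self (by positivity) (by norm_num)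
                _ ≤ _ := by gcongr
            · calc m * (1 / e * x ^ 3 / 6) = m / e * x ^ 3 / 6 * 1 := by ring
                _ ≤ _ := by gcongr
        _ = _ := by rw [hR]; norm_num [Nat.factorial]; ring
    · have i1 := bound_one_a x hx
      have i2 := bound_two_a x hx
      have hx0 := hx.1
      have hxL : x ≤ max 1 L := hx.2.trans (le_max_right _ _)
      calc |-primZ q1 x - m * primZ q2 x|
          ≤ |primZ q1 x| + m * |primZ q2 x| := by
            refine (abs_sub _ _).trans ?_
            rw [abs_neg, abs_mul, abs_of_pos hm]
        _ ≤ M / e * x ^ 3 / 6 + m * (1 / e * x ^ 2 / 2) := by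
            refine add_le_add (i1.trans_eq ?_) (mul_le_mul_of_nonneg_left (i2.trans_eq ?_) hm.le)
            <;> norm_num [Nat.factorial]
        _ ≤ M / e * x ^ 2 / 2 * max 1 L + m / e * x ^ 2 / 2 * max 1 L := by
            refine add_le_add ?_ ?_
            · calc M / e * x ^ 3 / 6 = (M / e * x ^ 2 / 2 * x) / 3 := by ring
                _ ≤ M / e * x ^ 2 / 2 * x := div_le_self (by positivity) (by norm_num)
                _ ≤ _ := by gcongr
            · calc m * (1 / e * x ^ 2 / 2) = m / e * x ^ 2 / 2 * 1 := by ring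
                _ ≤ _ := by gcongr
        _ = _ := by rw [hR]; norm_num [Nat.factorial]; ring
  | succ k ih =>
    obtain ⟨G, hG⟩ := ih
    set f : ℝ → ℝ := fun s => ρ s * genG ρ EI m (k + 1) s with hf
    set q : ℝ → ℝ := fun s => primZ (primZ f) s / EI s with hq
    have hg : genG ρ EI m (k + 1 + 1) = fun x => -primZ (primZ q) x := by
      funext x
      rw [← quad_eq]
      simp [genG, hf]
    have cf : ContinuousOn f (Set.Icc 0 L) :=
      hρc.mul fun x hx => (hG x hx).1.continuousWithinAt
    have c : ContinuousOn q (Set.Icc 0 L) := (primZ_cont (primZ_cont cf)).div hEc hE0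
    have bf : ∀ s ∈ Set.Icc (0:ℝ) L,
        |f s| ≤ (M * R ^ (k + 1)) * s ^ (4 * k + 3) / ((4 * k + 3).factorial : ℝ) := by
      intro s hs
      rw [hf, abs_mul]
      calc _ ≤ M * (R ^ (k + 1) * s ^ (4 * k + 3) / ((4 * k + 3).factorial : ℝ)) :=
            mul_le_mul (hρ s hs) (hG s hs).2.1 (abs_nonneg _) hM.le
        _ = _ := by ring
    have b := primZ_bound (div_bound he hE (primZ_bound (primZ_bound bf)))
    have bound_b := primZ_bound b
    have hc : M * R ^ (k + 1) / e ≤ R ^ (k + 1 + 1) := by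
      have : M / e ≤ R := by
        rw [hR]
        calc M / e = M / e * 1 := by ring
          _ ≤ (M + m) / e * max 1 L := by gcongr; linarith
      calc M * R ^ (k + 1) / e = R ^ (k + 1) * (M / e) := by ring
        _ ≤ R ^ (k + 1) * R := by gcongr
        _ = _ := by ring
    refine ⟨fun x => -primZ q x, fun x hx => ⟨?_, ?_, ?_⟩⟩
    · rw [hg]
      exact (primZ_deriv (primZ_cont c) hx).neg
    · have hx0 := hx.1
      rw [hg]
      simp only [abs_neg]
      refine (bound_b x hx).trans ?_
      rw [show 4 * k + 3 + 1 + 1 + 1 + 1 = 4 * (k + 1) + 3 by ring]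
      gcongr
    · have hx0 := hx.1
      simp only [abs_neg]
      refine (b x hx).trans ?_
      rw [show 4 * k + 3 + 1 + 1 + 1 = 4 * (k + 1) + 2 by ring]
      gcongr

/-- with `R₁ = ((max ρ + m)/(min EI))·max{1,L}`, for every `k ≥ 1` and
`x ∈ [0,L]`, `|g_k(x)| ≤ R₁^k x^(4k-1)/(4k-1)!` and `|g_k'(x)| ≤ R₁^k x^(4k-2)/(4k-2)!`. -/
theorem stmt2 (L m J : ℝ) (hL : 0 < L) (hm : 0 < m) (hJ : 0 < J)
    (ρ EI : ℝ → ℝ)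
    (hρ : ContDiffOn ℝ 4 ρ (Set.Icc 0 L)) (hEI : ContDiffOn ℝ 4 EI (Set.Icc 0 L))
    (hρpos : ∃ c > 0, ∀ x ∈ Set.Icc (0:ℝ) L, c ≤ ρ x)
    (hEIpos : ∃ c > 0, ∀ x ∈ Set.Icc (0:ℝ) L, c ≤ EI x)
    (R₁ : ℝ)
    (hR₁ : R₁ = (sSup (ρ '' Set.Icc 0 L) + m) / sInf (EI '' Set.Icc 0 L) * max 1 L)
    (k : ℕ) (hk : 1 ≤ k) :
    ∀ x ∈ Set.Icc (0:ℝ) L,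
      |genG ρ EI m k x| ≤ R₁ ^ k * x ^ (4 * k - 1) / ((4 * k - 1).factorial : ℝ) ∧
      |derivWithin (genG ρ EI m k) (Set.Icc 0 L) x| ≤
        R₁ ^ k * x ^ (4 * k - 2) / ((4 * k - 2).factorial : ℝ) := by
  obtain ⟨c, hc, hcE⟩ := hEIpos
  obtain ⟨d, hd, hdρ⟩ := hρpos
  have h0 : (0:ℝ) ∈ Set.Icc (0:ℝ) L := ⟨le_rfl, hL.le⟩
  have hbdd : BddAbove (ρ '' Set.Icc 0 L) := isCompact_Icc.bddAbove_image hρ.continuousOn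
  have hbdd_low : BddBelow (EI '' Set.Icc 0 L) := isCompact_Icc.bddBelow_image hEI.continuousOn
  have hM : ∀ x ∈ Set.Icc (0:ℝ) L, ρ x ≤ sSup (ρ '' Set.Icc 0 L) :=
    fun x hx => le_csSup hbdd (Set.mem_image_of_mem _ hx)
  have hE : ∀ x ∈ Set.Icc (0:ℝ) L, sInf (EI '' Set.Icc 0 L) ≤ EI x :=
    fun x hx => csInf_le hbdd_low (Set.mem_image_of_mem _ hx)
  have he : 0 < sInf (EI '' Set.Icc 0 L) := by
    refine hc.trans_le (le_csInf ⟨_, Set.mem_image_of_mem _ h0⟩ ?_)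
    rintro _ ⟨x, hx, rfl⟩
    exact hcE x hx
  have hM0 : 0 < sSup (ρ '' Set.Icc 0 L) := hd.trans_le ((hdρ 0 h0).trans (hM 0 h0))
  obtain ⟨j, rfl⟩ : ∃ j, k = j + 1 := ⟨k - 1, by omega⟩
  obtain ⟨G, hG⟩ := genG_key hm hM0 he hρ.continuousOn hEI.continuousOn
    (fun x hx => by rw [abs_of_pos (hd.trans_le (hdρ x hx))]; exact hM x hx) hE hR₁ j
  intro x hx
  obtain ⟨h1, h2, h3⟩ := hG x hx
  rw [h1.derivWithin (uniqueDiffOn_Icc hL x hx), show 4 * (j + 1) - 1 = 4 * j + 3 by omega,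
    show 4 * (j + 1) - 2 = 4 * j + 2 by omega]
  exact ⟨h2, h3⟩
end

section
/- Let T > 0, s ∈ (1,2) and y_1, y_2 ∈ G_s[0,T]. For (x,t) ∈ [0,L]×[0,T] define w(x,t) = Σ_{k≥0} g_k(x) y_1^{(2k)}(t) + Σ_{k≥0} h_k(x) y_2^{(2k)}(t). Then this series converges uniformly on [0,L]×[0,T]; moreover, for every integer m ≥ 0 and every j ∈ {0,1,2,3,4}, the termwise differentiated series Σ_{k≥0} g_k^{(j)}(x) y_1^{(2k+m)}(t) + Σ_{k≥0} h_k^{(j)}(x) y_2^{(2k+m)}(t) converges uniformly on [0,L]×[0,T] and equals the partial derivative ∂_t^m ∂_x^j w(x,t), which in particular exists and is continuous on [0,L]×[0,T]. -/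
open Set Filter intervalIntegral

/-- The formal series solution `w(x,t) = Σ_k g_k(x) y₁⁽²ᵏ⁾(t) + Σ_k h_k(x) y₂⁽²ᵏ⁾(t)`. -/
noncomputable def wSol (g h : ℕ → ℝ → ℝ) (y₁ y₂ : ℝ → ℝ) (x t : ℝ) : ℝ :=
  ∑' k : ℕ, (g k x * iteratedDeriv (2 * k) y₁ t + h k x * iteratedDeriv (2 * k) y₂ t)

lemma ext_exists {a b : ℝ} (hab : a ≤ b) (f : ℝ → ℝ) (hf : ContinuousOn f (Icc a b)) :
    ∃ F : ℝ → ℝ, Continuous F ∧ (∀ x ∈ Icc a b, F x = f x) ∧ (∀ x, ∃ y ∈ Icc a b, F x = f y) := by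
  refine ⟨fun x => f (projIcc a b hab x), ?_, ?_, ?_⟩
  · exact hf.comp_continuous (continuous_subtype_val.comp continuous_projIcc)
      (fun x => (projIcc a b hab x).2)
  · intro x hx
    simp [projIcc_of_mem hab hx]
  · intro x
    exact ⟨_, (projIcc a b hab x).2, rfl⟩

lemma chain_iter {a b : ℝ} (hab : a < b) (φ : ℕ → ℝ → ℝ) (N : ℕ)
    (h : ∀ j < N, ∀ x ∈ Icc a b, HasDerivWithinAt (φ j) (φ (j+1) x) (Icc a b) x) :
    ∀ j ≤ N, ∀ x ∈ Icc a b, iteratedDerivWithin j (φ 0) (Icc a b) x = φ j x := by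
  intro j
  induction j with
  | zero => intro _ x _; simp
  | succ j ih =>
    intro hj x hx
    rw [iteratedDerivWithin_succ]
    have h1 : EqOn (iteratedDerivWithin j (φ 0) (Icc a b)) (φ j) (Icc a b) :=
      fun y hy => ih (by omega) y hy
    rw [derivWithin_congr h1 (h1 hx)]
    exact (h j (by omega) x hx).derivWithin (uniqueDiffOn_Icc hab x hx)

lemma chain_contDiff {a b : ℝ} (hab : a < b) (φ : ℕ → ℝ → ℝ) (N : ℕ)
    (h : ∀ j < N, ∀ x ∈ Icc a b, HasDerivWithinAt (φ j) (φ (j+1) x) (Icc a b) x)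
    (hc : ContinuousOn (φ N) (Icc a b)) :
    ContDiffOn ℝ N (φ 0) (Icc a b) := by
  have hi := chain_iter hab φ N h
  have hcont : ∀ j ≤ N, ContinuousOn (φ j) (Icc a b) := by
    intro j hj
    rcases hj.lt_or_eq with h1 | h1
    · exact fun x hx => (h j h1 x hx).continuousWithinAt
    · rw [h1]; exact hc
  refine contDiffOn_of_continuousOn_differentiableOn_deriv (n := (N : ℕ∞)) ?_ ?_
  · intro j hj
    have hj' : j ≤ N := by exact_mod_cast hj
    exact (hcont j hj').congr (fun x hx => hi j hj' x hx)
  · intro j hj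
    have hj' : j < N := by exact_mod_cast hj
    have : DifferentiableOn ℝ (φ j) (Icc a b) := fun x hx => (h j hj' x hx).differentiableWithinAt
    exact this.congr (fun x hx => hi j hj'.le x hx)

lemma prim_deriv {p : ℝ → ℝ} (hp : Continuous p) (x : ℝ) :
    HasDerivAt (fun x => ∫ s in (0:ℝ)..x, p s) (p x) x :=
  (hp.integral_hasStrictDerivAt 0 x).hasDerivAt

lemma prim_cont {p : ℝ → ℝ} (hp : Continuous p) :
    Continuous (fun x => ∫ s in (0:ℝ)..x, p s) :=
  continuous_iff_continuousAt.2 fun x => (prim_deriv hp x).continuousAt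

lemma tsum_deriv {a b : ℝ} (hab : a ≤ b) (f f' : ℕ → ℝ → ℝ) (u : ℕ → ℝ) (hu : Summable u)
    (hf : ∀ k, ∀ x ∈ Icc a b, HasDerivWithinAt (f k) (f' k x) (Icc a b) x)
    (hc : ∀ k, ContinuousOn (f' k) (Icc a b))
    (hb : ∀ k, ∀ x ∈ Icc a b, |f' k x| ≤ u k)
    (hs : Summable fun k => f k a) :
    ∀ x ∈ Icc a b, HasDerivWithinAt (fun x => ∑' k, f k x) (∑' k, f' k x) (Icc a b) x := by
  choose F' hF'c hF'eq hF'v using fun k => ext_exists hab (f' k) (hc k)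
  let F : ℕ → ℝ → ℝ := fun k x => f k a + ∫ s in a..x, F' k s
  have hF : ∀ k x, HasDerivAt (F k) (F' k x) x := fun k x =>
    ((hF'c k).integral_hasStrictDerivAt a x).hasDerivAt.const_add _
  have hFeq : ∀ k, ∀ x ∈ Icc a b, F k x = f k x := by
    intro k
    refine eq_of_has_deriv_right_eq (f' := F' k) ?_ ?_ ?_ ?_ ?_
    · exact fun x _ => (hF k x).hasDerivWithinAt
    · intro x hx
      have h1 := hf k x ⟨hx.1, hx.2.le⟩
      rw [← hF'eq k x ⟨hx.1, hx.2.le⟩] at h1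
      exact h1.mono_of_mem_nhdsWithin (Icc_mem_nhdsGE_of_mem hx)
    · exact fun x _ => (hF k x).continuousAt.continuousWithinAt
    · exact fun x hx => (hf k x hx).continuousWithinAt
    · simp [F]
  have key := fun x => hasDerivAt_tsum (y₀ := a) hu hF (fun k x => by
    obtain ⟨y, hy, e⟩ := hF'v k x
    rw [e]; exact hb k y hy) (by simpa [F] using hs) x
  intro x hx
  have h2 := (key x).hasDerivWithinAt (s := Icc a b)
  have e1 : (∑' k, f' k x) = ∑' k, F' k x := tsum_congr fun k => (hF'eq k x hx).symm
  rw [e1]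
  exact h2.congr (fun y hy => tsum_congr fun k => (hFeq k y hy).symm)
    (tsum_congr fun k => (hFeq k x hx).symm)

lemma prim_bound {L C : ℝ} {n : ℕ} {p : ℝ → ℝ}
    (h : ∀ x ∈ Icc 0 L, |p x| ≤ C * x ^ n / n.factorial) :
    ∀ x ∈ Icc 0 L, |∫ s in (0:ℝ)..x, p s| ≤ C * x ^ (n+1) / (n+1).factorial := by
  intro x hx
  have h1 : |∫ s in (0:ℝ)..x, p s| ≤ ∫ s in (0:ℝ)..x, C * s ^ n / n.factorial := by
    rw [← Real.norm_eq_abs]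
    refine norm_integral_le_of_norm_le hx.1 (MeasureTheory.ae_of_all _ fun s hs => ?_)
      (Continuous.intervalIntegrable (by fun_prop) _ _)
    exact h s ⟨hs.1.le, hs.2.trans hx.2⟩
  refine h1.trans (le_of_eq ?_)
  have : ∀ s : ℝ, C * s ^ n / n.factorial = C / n.factorial * s ^ n := fun s => by ring
  simp_rw [this, integral_const_mul, integral_pow]
  rw [Nat.factorial_succ]
  push_cast
  have := Nat.factorial_ne_zero n
  field_simp
  simp

lemma summable_main (s B D : ℝ) (hs0 : 0 < s) (hs₂ : s < 2) (hB : 0 < B) (hD : 0 < D) (N : ℕ) :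
    Summable fun k : ℕ => B ^ k / ((4 * k).factorial : ℝ) *
      (D ^ (2 * k + N) * ((2 * k + N).factorial : ℝ) ^ s) := by
  set K : ℝ := B * D ^ 2 * ((N + 2 : ℝ) ^ 2) ^ s with hK
  have ht : Tendsto (fun k : ℕ => K * (4 * (k:ℝ) + 1) ^ (-(4 - 2 * s))) atTop (nhds (K * 0)) := by
    refine Tendsto.const_mul K ((tendsto_rpow_neg_atTop (by linarith)).comp ?_)
    refine tendsto_atTop_add_const_right _ _ ?_
    exact Tendsto.const_mul_atTop (by norm_num) tendsto_natCast_atTop_atTop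
  rw [mul_zero] at ht
  refine summable_of_ratio_norm_eventually_le (r := 1/2) (by norm_num) ?_
  filter_upwards [(tendsto_order.1 ht).2 (1/2) (by norm_num)] with k hk
  set a : ℝ := B ^ k / ((4 * k).factorial : ℝ) *
      (D ^ (2 * k + N) * ((2 * k + N).factorial : ℝ) ^ s) with ha
  have hapos : 0 ≤ a := by positivity
  rw [Real.norm_of_nonneg hapos, Real.norm_of_nonneg (by positivity)]
  refine le_trans ?_ (mul_le_mul_of_nonneg_right hk.le hapos)
  have e1 : ((4 * (k+1)).factorial : ℝ) =
      (4*k+4) * (4*k+3) * (4*k+2) * (4*k+1) * (4*k).factorial := by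
    rw [show 4 * (k+1) = 4*k+1+1+1+1 by ring]
    simp only [Nat.factorial_succ]; push_cast; ring
  have e2 : ((2 * (k+1) + N).factorial : ℝ) =
      ((2*k+N+2) * (2*k+N+1)) * (2*k+N).factorial := by
    rw [show 2 * (k+1) + N = 2*k+N+1+1 by ring]
    simp only [Nat.factorial_succ]; push_cast; ring
  rw [e1, e2, Real.mul_rpow (by positivity) (by positivity)]
  have hk0 : (0:ℝ) ≤ k := by positivity
  have hN0 : (0:ℝ) ≤ N := by positivity
  have h1 : (((2*k+N+2) * (2*k+N+1) : ℝ)) ^ s ≤ ((N+2:ℝ)^2) ^ s * (4*k+1) ^ (2*s) := by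
    have : ((4*k+1:ℝ)) ^ (2*s) = ((4*k+1:ℝ)^2)^s := by
      rw [Real.rpow_mul (by positivity)]; norm_num
    rw [this, ← Real.mul_rpow (by positivity) (by positivity)]
    refine Real.rpow_le_rpow (by positivity) ?_ hs0.le
    have : (2*k+N+2:ℝ) ≤ (N+2) * (4*k+1) := by nlinarith
    nlinarith
  have h2 : ((4*k+1:ℝ))^4 ≤ (4*k+4) * (4*k+3) * (4*k+2) * (4*k+1) := by
    have : ((4*k+1:ℝ))^4 = (4*k+1) * (4*k+1) * (4*k+1) * (4*k+1) := by ring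
    rw [this]; gcongr <;> norm_num
  have h3 : (4 * (k:ℝ) + 1) ^ (-(4 - 2 * s)) = (4*k+1) ^ (2*s) / (4*k+1)^4 := by
    rw [show -(4-2*s) = 2*s - (4:ℕ) by push_cast; ring, Real.rpow_sub (by positivity),
      Real.rpow_natCast]
  rw [h3, hK]
  calc B ^ (k + 1) / ((4 * k + 4) * (4 * k + 3) * (4 * k + 2) * (4 * k + 1) * ((4 * k).factorial:ℝ)) *
      (D ^ (2 * (k + 1) + N) * (((2 * k + N + 2) * (2 * k + N + 1) : ℝ) ^ s * ((2 * k + N).factorial:ℝ) ^ s))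
      = B * D^2 * (((2 * k + N + 2) * (2 * k + N + 1) : ℝ) ^ s / ((4 * k + 4) * (4 * k + 3) * (4 * k + 2) * (4 * k + 1))) * a := by
        rw [ha, show 2 * (k+1) + N = 2*k+N+2 by ring, pow_succ, pow_add D _ 2]
        field_simp
    _ ≤ B * D^2 * ((((N+2:ℝ)^2) ^ s * (4*k+1) ^ (2*s)) / (4*k+1)^4) * a := by
        gcongr
    _ = _ := by ring

lemma prim_bound' {L C : ℝ} (hC : 0 ≤ C) {p : ℝ → ℝ} (h : ∀ x ∈ Icc 0 L, |p x| ≤ C) :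
    ∀ x ∈ Icc 0 L, |∫ s in (0:ℝ)..x, p s| ≤ L * C := by
  intro x hx
  have h1 := prim_bound (L := L) (C := C) (n := 0) (p := p) (by simpa using h) x hx
  have h2 : C * x ≤ C * L := mul_le_mul_of_nonneg_left hx.2 hC
  simp at h1
  linarith

lemma exists_bound {a b : ℝ} {f : ℝ → ℝ} (hf : ContinuousOn f (Icc a b)) :
    ∃ C, 0 < C ∧ ∀ x ∈ Icc a b, |f x| ≤ C := by
  obtain ⟨C, hC⟩ := isCompact_Icc.exists_bound_of_continuousOn hf
  exact ⟨max C 1, by positivity, fun x hx => (hC x hx).trans (le_max_left _ _)⟩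

lemma exists_bound_iter {L : ℝ} (hL : 0 < L) {f : ℝ → ℝ} (hf : ContDiffOn ℝ 4 f (Icc 0 L)) :
    ∃ C, 0 < C ∧ ∀ j ≤ 4, ∀ x ∈ Icc 0 L, |iteratedDerivWithin j f (Icc 0 L) x| ≤ C := by
  have h : ∀ j : ℕ, ∃ C, 0 < C ∧ (j ≤ 4 → ∀ x ∈ Icc 0 L,
      |iteratedDerivWithin j f (Icc 0 L) x| ≤ C) := by
    intro j
    by_cases hj : j ≤ 4
    · obtain ⟨C, hC, h⟩ := exists_bound
        (hf.continuousOn_iteratedDerivWithin (m := j) (by exact_mod_cast hj) (uniqueDiffOn_Icc hL))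
      exact ⟨C, hC, fun _ => h⟩
    · exact ⟨1, one_pos, fun h => absurd h hj⟩
  choose C hC h using h
  refine ⟨∑ j ∈ Finset.range 5, C j, Finset.sum_pos (fun j _ => hC j) (by simp), ?_⟩
  intro j hj x hx
  exact (h j hj x hx).trans (Finset.single_le_sum (f := C) (fun i _ => (hC i).le)
    (Finset.mem_range.2 (by omega)))

lemma W_lemma {L : ℝ} (hL : 0 < L) {a : ℝ → ℝ} (hac : Continuous a)
    (ha : ContDiffOn ℝ 4 a (Icc 0 L)) :
    ∃ K, 0 < K ∧ ∀ q q1 q2 : ℝ → ℝ, (∀ x, HasDerivAt q (q1 x) x) →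
      (∀ x, HasDerivAt q1 (q2 x) x) → Continuous q2 →
      Continuous (fun x => ∫ s₁ in (0:ℝ)..x, ∫ s₂ in (0:ℝ)..s₁, a s₂ * q s₂) ∧
      ContDiffOn ℝ 4 (fun x => ∫ s₁ in (0:ℝ)..x, ∫ s₂ in (0:ℝ)..s₁, a s₂ * q s₂) (Icc 0 L) ∧
      ∀ R, (∀ x ∈ Icc 0 L, |q x| ≤ R ∧ |q1 x| ≤ R ∧ |q2 x| ≤ R) →
        ∀ j ≤ 4, ∀ x ∈ Icc 0 L, |iteratedDerivWithin j
          (fun x => ∫ s₁ in (0:ℝ)..x, ∫ s₂ in (0:ℝ)..s₁, a s₂ * q s₂) (Icc 0 L) x| ≤ K * R := by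
  obtain ⟨A, hA, hAb⟩ := exists_bound_iter hL ha
  have hU := uniqueDiffOn_Icc hL
  set a1 := iteratedDerivWithin 1 a (Icc 0 L) with ha1
  set a2 := iteratedDerivWithin 2 a (Icc 0 L) with ha2
  have hd0 : ∀ x ∈ Icc 0 L, HasDerivWithinAt a (a1 x) (Icc 0 L) x := by
    intro x hx
    have := (ha.differentiableOn (by norm_num) x hx).hasDerivWithinAt
    rwa [← iteratedDerivWithin_one] at this
  have hd1 : ∀ x ∈ Icc 0 L, HasDerivWithinAt a1 (a2 x) (Icc 0 L) x := by
    intro x hx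
    have := (ha.differentiableOn_iteratedDerivWithin (m := 1) (by norm_num) hU x hx).hasDerivWithinAt
    rwa [← iteratedDerivWithin_succ] at this
  have hc2 : ContinuousOn a2 (Icc 0 L) :=
    ha.continuousOn_iteratedDerivWithin (m := 2) (by norm_num) hU
  have hb0 : ∀ x ∈ Icc 0 L, |a x| ≤ A := fun x hx => by simpa using hAb 0 (by norm_num) x hx
  have hb1 : ∀ x ∈ Icc 0 L, |a1 x| ≤ A := fun x hx => hAb 1 (by norm_num) x hx
  have hb2 : ∀ x ∈ Icc 0 L, |a2 x| ≤ A := fun x hx => hAb 2 (by norm_num) x hx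
  refine ⟨A * (4 + L + L * L), by positivity, ?_⟩
  intro q q1 q2 hq hq1 hq2c
  have hqc : Continuous q := continuous_iff_continuousAt.2 fun x => (hq x).continuousAt
  have hq1c : Continuous q1 := continuous_iff_continuousAt.2 fun x => (hq1 x).continuousAt
  have haq : Continuous fun x => a x * q x := hac.mul hqc
  let φ : ℕ → ℝ → ℝ
    | 0 => fun x => ∫ s₁ in (0:ℝ)..x, ∫ s₂ in (0:ℝ)..s₁, a s₂ * q s₂
    | 1 => fun x => ∫ s₂ in (0:ℝ)..x, a s₂ * q s₂
    | 2 => fun x => a x * q x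
    | 3 => fun x => a1 x * q x + a x * q1 x
    | _ => fun x => (a2 x * q x + a1 x * q1 x) + (a1 x * q1 x + a x * q2 x)
  have hφ : ∀ j < 4, ∀ x ∈ Icc 0 L, HasDerivWithinAt (φ j) (φ (j+1) x) (Icc 0 L) x := by
    intro j hj x hx
    interval_cases j
    · exact (prim_deriv (prim_cont haq) x).hasDerivWithinAt
    · exact (prim_deriv haq x).hasDerivWithinAt
    · exact (hd0 x hx).mul (hq x).hasDerivWithinAt
    · exact ((hd1 x hx).mul (hq x).hasDerivWithinAt).add
        ((hd0 x hx).mul (hq1 x).hasDerivWithinAt)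
  have hc1 : ContinuousOn a1 (Icc 0 L) := fun x hx => (hd1 x hx).continuousWithinAt
  have hφ4 : ContinuousOn (φ 4) (Icc 0 L) := by
    exact ((hc2.mul hqc.continuousOn).add (hc1.mul hq1c.continuousOn)).add
      ((hc1.mul hq1c.continuousOn).add (hac.continuousOn.mul hq2c.continuousOn))
  refine ⟨prim_cont (prim_cont haq), by exact_mod_cast chain_contDiff hL φ 4 hφ hφ4, ?_⟩
  intro R hR j hj x hx
  have hR0 : 0 ≤ R := (abs_nonneg _).trans (hR 0 ⟨le_rfl, hL.le⟩).1
  have e := chain_iter hL φ 4 hφ j hj x hx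
  change |iteratedDerivWithin j (φ 0) (Icc 0 L) x| ≤ _
  rw [e]
  have hAR : 0 ≤ A * R := by positivity
  have hm : ∀ u v : ℝ, |u| ≤ A → |v| ≤ R → |u * v| ≤ A * R := fun u v hu hv => by
    rw [abs_mul]; exact mul_le_mul hu hv (abs_nonneg _) hA.le
  have B2 : ∀ x ∈ Icc 0 L, |a x * q x| ≤ A * R := fun x hx => hm _ _ (hb0 x hx) (hR x hx).1
  have B1 := prim_bound' hAR B2
  have B0 := prim_bound' (by positivity) B1
  have hLL : 0 ≤ L * (A * R) := by positivity
  have hLL2 : 0 ≤ L * (L * (A * R)) := by positivity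
  have hKR : A * (4 + L + L * L) * R = 4 * (A * R) + L * (A * R) + L * (L * (A * R)) := by ring
  rw [hKR]
  have t1 := hm _ _ (hb1 x hx) (hR x hx).1
  have t2 := hm _ _ (hb0 x hx) (hR x hx).2.1
  have t3 := hm _ _ (hb2 x hx) (hR x hx).1
  have t4 := hm _ _ (hb1 x hx) (hR x hx).2.1
  have t5 := hm _ _ (hb0 x hx) (hR x hx).2.2
  interval_cases j
  · exact (B0 x hx).trans (by linarith)
  · exact (B1 x hx).trans (by linarith)
  · exact (B2 x hx).trans (by linarith)
  · exact (abs_add_le _ _).trans (by linarith)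
  · refine (abs_add_le _ _).trans ?_
    have := abs_add_le (a2 x * q x) (a1 x * q1 x)
    have := abs_add_le (a1 x * q1 x) (a x * q2 x)
    linarith

lemma gen_bounds {L : ℝ} (hL : 0 < L) {a r : ℝ → ℝ} (hac : Continuous a)
    (ha : ContDiffOn ℝ 4 a (Icc 0 L)) (hr : Continuous r) (f : ℕ → ℝ → ℝ)
    (h0 : ContDiffOn ℝ 4 (f 0) (Icc 0 L)) (h1c : Continuous (f 1))
    (h1 : ContDiffOn ℝ 4 (f 1) (Icc 0 L))
    (hf : ∀ k, f (k + 2) = fun x => ∫ s₁ in (0:ℝ)..x, ∫ s₂ in (0:ℝ)..s₁,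
      a s₂ * -(∫ s₃ in (0:ℝ)..s₂, ∫ s₄ in (0:ℝ)..s₃, r s₄ * f (k + 1) s₄)) :
    (∀ k, ContDiffOn ℝ 4 (f k) (Icc 0 L)) ∧ ∃ (c : ℕ → ℝ) (M B : ℝ), 0 < B ∧
      (∀ k, ∀ j ≤ 4, ∀ x ∈ Icc 0 L, |iteratedDerivWithin j (f k) (Icc 0 L) x| ≤ c k) ∧
      ∀ k, c (k + 2) = M * (B ^ k / ((4 * k).factorial : ℝ)) := by
  obtain ⟨K, hK, HW⟩ := W_lemma hL hac ha
  have hcont : ∀ k, Continuous (f (k+1)) := by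
    intro k
    induction k with
    | zero => exact h1c
    | succ k ih =>
      have hc := prim_cont (prim_cont (hr.mul ih))
      rw [hf k]
      exact prim_cont (prim_cont (hac.mul hc.neg))
  have HW' := fun k => HW
    (fun x => -(∫ s₃ in (0:ℝ)..x, ∫ s₄ in (0:ℝ)..s₃, r s₄ * f (k + 1) s₄))
    (fun x => -(∫ s₄ in (0:ℝ)..x, r s₄ * f (k + 1) s₄)) (fun x => -(r x * f (k + 1) x))
    (fun x => (prim_deriv (prim_cont (hr.mul (hcont k))) x).neg)
    (fun x => (prim_deriv (hr.mul (hcont k)) x).neg) (hr.mul (hcont k)).neg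
  simp_rw [← hf] at HW'
  refine ⟨fun k => ?_, ?_⟩
  · match k with
    | 0 => exact h0
    | 1 => exact h1
    | (k + 2) => exact (HW' k).2.1
  obtain ⟨c0, hc0, hb0⟩ := exists_bound_iter hL h0
  obtain ⟨c1, hc1, hb1⟩ := exists_bound_iter hL h1
  obtain ⟨A, hA, hAb⟩ := exists_bound (a := 0) (b := L) hac.continuousOn
  obtain ⟨P, hP, hPb⟩ := exists_bound (a := 0) (b := L) hr.continuousOn
  have hfb : ∀ k, ∀ x ∈ Icc 0 L,
      |f (k+1) x| ≤ (c1 * (A * P) ^ k) * x ^ (4 * k) / (4 * k).factorial := by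
    intro k
    induction k with
    | zero => intro x hx; simpa using hb1 0 (by norm_num) x hx
    | succ k ih =>
      have s1 : ∀ x ∈ Icc 0 L, |r x * f (k+1) x| ≤
          (P * (c1 * (A * P) ^ k)) * x ^ (4 * k) / (4 * k).factorial := by
        intro x hx
        rw [abs_mul, mul_assoc P, mul_div_assoc P]
        exact mul_le_mul (hPb x hx) (ih x hx) (abs_nonneg _) hP.le
      have s2 := prim_bound (prim_bound s1)
      have s3 : ∀ x ∈ Icc 0 L,
          |a x * -(∫ s₃ in (0:ℝ)..x, ∫ s₄ in (0:ℝ)..s₃, r s₄ * f (k + 1) s₄)| ≤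
          (c1 * (A * P) ^ (k+1)) * x ^ (4 * k + 1 + 1) / (4 * k + 1 + 1).factorial := by
        intro x hx
        rw [abs_mul, abs_neg, show c1 * (A * P) ^ (k+1) = A * (P * (c1 * (A * P) ^ k)) by ring,
          mul_assoc A, mul_div_assoc A]
        exact mul_le_mul (hAb x hx) (s2 x hx) (abs_nonneg _) hA.le
      have s4 := prim_bound (prim_bound s3)
      intro x hx
      have := s4 x hx
      rw [hf k]
      exact this
  let M : ℝ := K * ((1 + L + L * L) * (P * c1))
  refine ⟨fun k => match k with
    | 0 => c0
    | 1 => c1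
    | (k + 2) => M * ((A * P * L ^ 4) ^ k / ((4 * k).factorial : ℝ)), M, A * P * L ^ 4,
    by positivity, ?_, fun k => rfl⟩
  intro k
  match k with
  | 0 => exact hb0
  | 1 => exact hb1
  | (k + 2) =>
    intro j hj x hx
    set R : ℝ := P * c1 * ((A * P * L ^ 4) ^ k / ((4 * k).factorial : ℝ)) with hR
    have hR0 : 0 ≤ R := by positivity
    have s1 : ∀ x ∈ Icc 0 L, |r x * f (k+1) x| ≤ R := by
      intro x hx
      have hx0 := hx.1
      have hxL := hx.2
      have : |f (k+1) x| ≤ c1 * ((A * P * L ^ 4) ^ k / ((4 * k).factorial : ℝ)) := by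
        refine (hfb k x hx).trans ?_
        rw [mul_pow (A * P), ← pow_mul L, ← mul_div_assoc, ← mul_assoc]
        gcongr
      rw [abs_mul, hR, mul_assoc P]
      exact mul_le_mul (hPb x hx) this (abs_nonneg _) hP.le
    have s2 := prim_bound' hR0 s1
    have s3 := prim_bound' (by positivity) s2
    have h1 : 0 ≤ L * R := by positivity
    have h2 : 0 ≤ L * (L * R) := by positivity
    have e : (1 + L + L * L) * R = R + L * R + L * (L * R) := by ring
    have := (HW' k).2.2 ((1 + L + L * L) * R) (fun x hx => by
      simp only [abs_neg]
      rw [e]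
      exact ⟨(s3 x hx).trans (by linarith), (s2 x hx).trans (by linarith),
        (s1 x hx).trans (by linarith)⟩) j hj x hx
    refine this.trans (le_of_eq ?_)
    simp only [M, hR]
    ring

lemma icongr {L : ℝ} {u v : ℝ → ℝ} (h : ∀ s ∈ Icc 0 L, u s = v s) :
    ∀ x ∈ Icc 0 L, (∫ s in (0:ℝ)..x, u s) = ∫ s in (0:ℝ)..x, v s := by
  intro x hx
  refine integral_congr fun s hs => ?_
  rw [uIcc_of_le hx.1] at hs
  exact h s ⟨hs.1, hs.2.trans hx.2⟩

lemma icongr4 {L : ℝ} {u v : ℝ → ℝ → ℝ}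
    (h : ∀ s ∈ Icc 0 L, ∀ t ∈ Icc 0 L, u s t = v s t) :
    ∀ x ∈ Icc 0 L,
      (∫ s₁ in (0:ℝ)..x, ∫ s₂ in (0:ℝ)..s₁, ∫ s₃ in (0:ℝ)..s₂, ∫ s₄ in (0:ℝ)..s₃, u s₂ s₄) =
      ∫ s₁ in (0:ℝ)..x, ∫ s₂ in (0:ℝ)..s₁, ∫ s₃ in (0:ℝ)..s₂, ∫ s₄ in (0:ℝ)..s₃, v s₂ s₄ :=
  icongr fun _ h1 => icongr (fun s2 h2 => icongr (fun _ h3 => icongr (fun s4 h4 =>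
    h s2 h2 s4 h4) _ h3) _ h2) _ h1

lemma genG_congr {L m : ℝ} {ρ EI ρ' EI' : ℝ → ℝ} (h1 : ∀ x ∈ Icc 0 L, ρ' x = ρ x)
    (h2 : ∀ x ∈ Icc 0 L, EI' x = EI x) (k : ℕ) :
    ∀ x ∈ Icc 0 L, genG ρ EI m k x = genG ρ' EI' m k x := by
  induction k with
  | zero => intro x _; simp [genG]
  | succ k ih =>
    intro x hx
    cases k with
    | zero =>
      simp only [genG]
      rw [icongr4 (v := fun s t => ρ' t / EI' s) (fun s hs t ht => by rw [h1 t ht, h2 s hs]) x hx,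
        icongr (fun _ h1 => icongr (u := fun s₂ => ∫ _s₃ in (0:ℝ)..s₂, 1 / EI s₂)
          (v := fun s₂ => ∫ _s₃ in (0:ℝ)..s₂, 1 / EI' s₂)
          (fun s2 hs2 => by rw [h2 s2 hs2]) _ h1) x hx]
    | succ k =>
      simp only [genG]
      rw [icongr4 (v := fun s t => ρ' t * genG ρ' EI' m (k+1) t / EI' s)
        (fun s hs t ht => by rw [h1 t ht, h2 s hs, ih t ht]) x hx]

lemma genH_congr {L m : ℝ} {ρ EI ρ' EI' : ℝ → ℝ} (h1 : ∀ x ∈ Icc 0 L, ρ' x = ρ x)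
    (h2 : ∀ x ∈ Icc 0 L, EI' x = EI x) (k : ℕ) :
    ∀ x ∈ Icc 0 L, genH ρ EI m k x = genH ρ' EI' m k x := by
  induction k with
  | zero => intro x _; simp [genH]
  | succ k ih =>
    intro x hx
    cases k with
    | zero =>
      simp only [genH]
      rw [icongr4 (v := fun s t => t * ρ' t / EI' s)
        (fun s hs t ht => by rw [h1 t ht, h2 s hs]) x hx,
        icongr (fun _ h1 => icongr (u := fun s₂ => 1 / EI s₂) (v := fun s₂ => 1 / EI' s₂)
          (fun s2 hs2 => by rw [h2 s2 hs2]) _ h1) x hx]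
    | succ k =>
      simp only [genH]
      rw [icongr4 (v := fun s t => ρ' t * genH ρ' EI' m (k+1) t / EI' s)
        (fun s hs t ht => by rw [h1 t ht, h2 s hs, ih t ht]) x hx]

lemma pull (a p : ℝ → ℝ) (x : ℝ) :
    (∫ s₁ in (0:ℝ)..x, ∫ s₂ in (0:ℝ)..s₁, ∫ s₃ in (0:ℝ)..s₂, ∫ s₄ in (0:ℝ)..s₃,
      p s₄ / a s₂) = ∫ s₁ in (0:ℝ)..x, ∫ s₂ in (0:ℝ)..s₁, (1 / a s₂) *
        (∫ s₃ in (0:ℝ)..s₂, ∫ s₄ in (0:ℝ)..s₃, p s₄) := by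
  simp_rw [integral_div]
  simp_rw [div_mul_eq_mul_div, one_mul]

/-- The conclusion about a family of generating functions. -/
def GoodFam (L : ℝ) (f : ℕ → ℝ → ℝ) : Prop :=
  (∀ k, ContDiffOn ℝ 4 (f k) (Icc 0 L)) ∧ ∃ (c : ℕ → ℝ) (M B : ℝ), 0 < B ∧
      (∀ k, ∀ j ≤ 4, ∀ x ∈ Icc 0 L, |iteratedDerivWithin j (f k) (Icc 0 L) x| ≤ c k) ∧
      ∀ k, c (k + 2) = M * (B ^ k / ((4 * k).factorial : ℝ))

lemma GoodFam.congr {L : ℝ} {f f' : ℕ → ℝ → ℝ} (h : GoodFam L f)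
    (e : ∀ k, ∀ x ∈ Icc 0 L, f' k x = f k x) : GoodFam L f' := by
  obtain ⟨h1, c, M, B, hB, h2, h3⟩ := h
  refine ⟨fun k => (h1 k).congr (e k), c, M, B, hB, fun k j hj x hx => ?_, h3⟩
  rw [iteratedDerivWithin_congr (e k) hx]
  exact h2 k j hj x hx

lemma good_both {L m J : ℝ} (hL : 0 < L) {ρ EI : ℝ → ℝ}
    (hρ : ContDiffOn ℝ 4 ρ (Set.Icc 0 L)) (hEI : ContDiffOn ℝ 4 EI (Set.Icc 0 L))
    (hEIpos : ∃ c > 0, ∀ x ∈ Set.Icc (0:ℝ) L, c ≤ EI x) :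
    GoodFam L (genG ρ EI m) ∧ GoodFam L (genH ρ EI J) := by
  obtain ⟨r, hr, hre, -⟩ := ext_exists hL.le ρ hρ.continuousOn
  obtain ⟨E, hE, hEe, hEv⟩ := ext_exists hL.le EI hEI.continuousOn
  obtain ⟨c, hc, hcE⟩ := hEIpos
  have hE0 : ∀ x, E x ≠ 0 := by
    intro x
    obtain ⟨y, hy, e⟩ := hEv x
    have := hcE y hy
    rw [e]; linarith
  have hac : Continuous fun x => 1 / E x := continuous_const.div hE hE0
  have ha : ContDiffOn ℝ 4 (fun x => 1 / E x) (Icc 0 L) :=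
    contDiffOn_const.div (hEI.congr hEe) (fun x _ => hE0 x)
  obtain ⟨K, hK, HW⟩ := W_lemma hL hac ha
  constructor
  · refine GoodFam.congr ?_ (genG_congr hre hEe)
    have W1 := HW _ _ _ (prim_deriv (prim_cont hr)) (prim_deriv hr) hr
    have W2 := HW (fun x => x) (fun _ => 1) (fun _ => 0) (fun x => hasDerivAt_id x)
      (fun x => hasDerivAt_const x 1) continuous_const
    have e1 : genG r E m 1 = fun x =>
        -(∫ s₁ in (0:ℝ)..x, ∫ s₂ in (0:ℝ)..s₁, (1 / E s₂) *
          (∫ s₃ in (0:ℝ)..s₂, ∫ s₄ in (0:ℝ)..s₃, r s₄))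
        - m * ∫ s₁ in (0:ℝ)..x, ∫ s₂ in (0:ℝ)..s₁, (1 / E s₂) * s₂ := by
      funext x
      simp only [genG]
      rw [pull E r x]
      simp [mul_comm]
    refine gen_bounds hL hac ha hr _ ?_ ?_ ?_ ?_
    · simp only [genG]; exact contDiffOn_const
    · rw [e1]; exact W1.1.neg.sub (continuous_const.mul W2.1)
    · rw [e1]; exact W1.2.1.neg.sub (contDiffOn_const.mul W2.2.1)
    · intro k
      funext x
      simp only [genG]
      rw [pull E (fun s => r s * genG r E m (k+1) s) x]
      simp
  · refine GoodFam.congr ?_ (genH_congr hre hEe)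
    have hr' : Continuous fun s => s * r s := continuous_id.mul hr
    have W1 := HW _ _ _ (prim_deriv (prim_cont hr')) (prim_deriv hr') hr'
    have W2 := HW (fun x => 1) (fun _ => 0) (fun _ => 0) (fun x => hasDerivAt_const x 1)
      (fun x => hasDerivAt_const x 0) continuous_const
    have e1 : genH r E J 1 = fun x =>
        -(∫ s₁ in (0:ℝ)..x, ∫ s₂ in (0:ℝ)..s₁, (1 / E s₂) *
          (∫ s₃ in (0:ℝ)..s₂, ∫ s₄ in (0:ℝ)..s₃, s₄ * r s₄))
        + J * ∫ s₁ in (0:ℝ)..x, ∫ s₂ in (0:ℝ)..s₁, (1 / E s₂) * 1 := by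
      funext x
      simp only [genH]
      rw [pull E (fun s => s * r s) x]
      simp
    refine gen_bounds hL hac ha hr _ ?_ ?_ ?_ ?_
    · simp only [genH]; exact contDiffOn_id
    · rw [e1]; exact W1.1.neg.add (continuous_const.mul W2.1)
    · rw [e1]; exact W1.2.1.neg.add (contDiffOn_const.mul W2.2.1)
    · intro k
      funext x
      simp only [genH]
      rw [pull E (fun s => r s * genH r E J (k+1) s) x]
      simp

lemma sum_aux {s D M B : ℝ} (hs0 : 0 < s) (hs₂ : s < 2) (hD : 0 < D) (hB : 0 < B) {c : ℕ → ℝ}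
    (hc : ∀ k, c (k + 2) = M * (B ^ k / ((4 * k).factorial : ℝ))) (n : ℕ) :
    Summable fun k : ℕ => c k * (D ^ (2 * k + n + 1) * ((2 * k + n).factorial : ℝ) ^ s) := by
  rw [← summable_nat_add_iff 2]
  refine ((summable_main s B D hs0 hs₂ hB hD (n + 4)).mul_left (M * D)).congr fun k => ?_
  rw [hc, show 2 * (k + 2) + n = 2 * k + (n + 4) by ring, pow_succ]
  ring

lemma main_of_good {L T s : ℝ} (hL : 0 < L) (hT : 0 < T) (hs₁ : 1 < s) (hs₂ : s < 2)
    {g h : ℕ → ℝ → ℝ} (hg : GoodFam L g) (hh : GoodFam L h)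
    {y₁ y₂ : ℝ → ℝ} (hy₁ : MemGevrey s T y₁) (hy₂ : MemGevrey s T y₂)
    (w : ℝ → ℝ → ℝ) (hw : w = wSol g h y₁ y₂) :
    TendstoUniformlyOn
      (fun N (q : ℝ × ℝ) => ∑ k ∈ Finset.range N,
        (g k q.1 * iteratedDeriv (2 * k) y₁ q.2 +
          h k q.1 * iteratedDeriv (2 * k) y₂ q.2))
      (fun q => w q.1 q.2) atTop (Set.Icc 0 L ×ˢ Set.Icc 0 T) ∧
    (∀ t ∈ Set.Icc (0:ℝ) T, ContDiffOn ℝ 4 (fun ξ => w ξ t) (Set.Icc 0 L)) ∧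
    (∀ (j : ℕ), j ≤ 4 → ∀ x ∈ Set.Icc (0:ℝ) L,
      ContDiffOn ℝ (⊤ : ℕ∞)
        (fun τ => iteratedDerivWithin j (fun ξ => w ξ τ) (Set.Icc 0 L) x) (Set.Icc 0 T)) ∧
    (∀ (n : ℕ) (j : ℕ), j ≤ 4 →
      TendstoUniformlyOn
        (fun N (q : ℝ × ℝ) => ∑ k ∈ Finset.range N,
          (iteratedDerivWithin j (g k) (Set.Icc 0 L) q.1 *
              iteratedDeriv (2 * k + n) y₁ q.2 +
            iteratedDerivWithin j (h k) (Set.Icc 0 L) q.1 *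
              iteratedDeriv (2 * k + n) y₂ q.2))
        (fun q => iteratedDerivWithin n
            (fun τ => iteratedDerivWithin j (fun ξ => w ξ τ) (Set.Icc 0 L) q.1)
            (Set.Icc 0 T) q.2)
        atTop (Set.Icc 0 L ×ˢ Set.Icc 0 T) ∧
      ContinuousOn
        (fun q : ℝ × ℝ => iteratedDerivWithin n
            (fun τ => iteratedDerivWithin j (fun ξ => w ξ τ) (Set.Icc 0 L) q.1)
            (Set.Icc 0 T) q.2)
        (Set.Icc 0 L ×ˢ Set.Icc 0 T)) := by
  obtain ⟨hgC, cg, Mg, Bg, hBg, hgb, hcg⟩ := hg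
  obtain ⟨hhC, ch, Mh, Bh, hBh, hhb, hch⟩ := hh
  obtain ⟨hy1C, D1, hD1, hy1b⟩ := hy₁
  obtain ⟨hy2C, D2, hD2, hy2b⟩ := hy₂
  have hU := uniqueDiffOn_Icc hL
  let term : ℕ → ℕ → ℕ → ℝ × ℝ → ℝ := fun j n k q =>
    iteratedDerivWithin j (g k) (Set.Icc 0 L) q.1 * iteratedDeriv (2 * k + n) y₁ q.2 +
      iteratedDerivWithin j (h k) (Set.Icc 0 L) q.1 * iteratedDeriv (2 * k + n) y₂ q.2
  let u : ℕ → ℕ → ℝ := fun n k =>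
    cg k * (D1 ^ (2 * k + n + 1) * ((2 * k + n).factorial : ℝ) ^ s) +
      ch k * (D2 ^ (2 * k + n + 1) * ((2 * k + n).factorial : ℝ) ^ s)
  have hu : ∀ n, Summable (u n) := fun n =>
    (sum_aux (by linarith) hs₂ hD1 hBg hcg n).add (sum_aux (by linarith) hs₂ hD2 hBh hch n)
  have hbound : ∀ j ≤ 4, ∀ n k, ∀ q ∈ Icc 0 L ×ˢ Icc 0 T, ‖term j n k q‖ ≤ u n k := by
    intro j hj n k q hq
    refine (abs_add_le _ _).trans (add_le_add ?_ ?_)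
    · rw [abs_mul]
      have h1 := hgb k j hj q.1 hq.1
      exact mul_le_mul h1 (hy1b _ _ hq.2) (abs_nonneg _) ((abs_nonneg _).trans h1)
    · rw [abs_mul]
      have h1 := hhb k j hj q.1 hq.1
      exact mul_le_mul h1 (hy2b _ _ hq.2) (abs_nonneg _) ((abs_nonneg _).trans h1)
  have hyd : ∀ {y : ℝ → ℝ}, ContDiff ℝ (⊤ : ℕ∞) y → ∀ n t,
      HasDerivAt (iteratedDeriv n y) (iteratedDeriv (n+1) y t) t := by
    intro y hy n t
    rw [iteratedDeriv_succ]
    exact (hy.differentiable_iteratedDeriv n (by exact_mod_cast WithTop.coe_lt_top _) t).hasDerivAt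
  have hyc : ∀ {y : ℝ → ℝ}, ContDiff ℝ (⊤ : ℕ∞) y → ∀ n, Continuous (iteratedDeriv n y) :=
    fun hy n => continuous_iff_continuousAt.2 fun t => (hyd hy n t).continuousAt
  have hfd : ∀ {f : ℝ → ℝ}, ContDiffOn ℝ 4 f (Icc 0 L) → ∀ j < 4, ∀ x ∈ Icc 0 L,
      HasDerivWithinAt (iteratedDerivWithin j f (Icc 0 L))
        (iteratedDerivWithin (j+1) f (Icc 0 L) x) (Icc 0 L) x := by
    intro f hf j hj x hx
    rw [iteratedDerivWithin_succ]
    exact (hf.differentiableOn_iteratedDerivWithin (m := j) (by exact_mod_cast hj)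
      hU x hx).hasDerivWithinAt
  have hfc : ∀ {f : ℝ → ℝ}, ContDiffOn ℝ 4 f (Icc 0 L) → ∀ j ≤ 4,
      ContinuousOn (iteratedDerivWithin j f (Icc 0 L)) (Icc 0 L) :=
    fun hf j hj => hf.continuousOn_iteratedDerivWithin (m := j) (by exact_mod_cast hj) hU
  have hcont : ∀ j ≤ 4, ∀ n k, ContinuousOn (term j n k) (Icc 0 L ×ˢ Icc 0 T) := by
    intro j hj n k
    have c1 := (hfc (hgC k) j hj).comp continuousOn_fst
      (fun q (hq : q ∈ Icc 0 L ×ˢ Icc 0 T) => hq.1)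
    have c2 := (hfc (hhC k) j hj).comp continuousOn_fst
      (fun q (hq : q ∈ Icc 0 L ×ˢ Icc 0 T) => hq.1)
    exact (c1.mul ((hyc hy1C (2*k+n)).comp continuous_snd).continuousOn).add
      (c2.mul ((hyc hy2C (2*k+n)).comp continuous_snd).continuousOn)
  let F : ℕ → ℕ → ℝ × ℝ → ℝ := fun j n q => ∑' k, term j n k q
  have hFu : ∀ j ≤ 4, ∀ n, TendstoUniformlyOn (fun N q => ∑ k ∈ Finset.range N, term j n k q)
      (F j n) atTop (Icc 0 L ×ˢ Icc 0 T) := fun j hj n =>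
    tendstoUniformlyOn_tsum_nat (hu n) (hbound j hj n)
  have hFc : ∀ j ≤ 4, ∀ n, ContinuousOn (F j n) (Icc 0 L ×ˢ Icc 0 T) := fun j hj n =>
    continuousOn_tsum (hcont j hj n) (hu n) (hbound j hj n)
  have hsum : ∀ j ≤ 4, ∀ n, ∀ q ∈ Icc 0 L ×ˢ Icc 0 T, Summable fun k => term j n k q :=
    fun j hj n q hq => (hu n).of_norm_bounded (fun k => hbound j hj n k q hq)
  have h0L : (0:ℝ) ∈ Icc 0 L := ⟨le_rfl, hL.le⟩
  have h0T : (0:ℝ) ∈ Icc 0 T := ⟨le_rfl, hT.le⟩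
  have hFx : ∀ t ∈ Icc 0 T, ∀ j < 4, ∀ x ∈ Icc 0 L,
      HasDerivWithinAt (fun ξ => F j 0 (ξ, t)) (F (j+1) 0 (x, t)) (Icc 0 L) x := by
    intro t ht j hj
    refine tsum_deriv hL.le (fun k ξ => term j 0 k (ξ, t)) (fun k ξ => term (j+1) 0 k (ξ, t))
      (u 0) (hu 0) ?_ ?_ ?_ ?_
    · intro k x hx
      exact ((hfd (hgC k) j hj x hx).mul_const (iteratedDeriv (2 * k + 0) y₁ t)).add
        ((hfd (hhC k) j hj x hx).mul_const (iteratedDeriv (2 * k + 0) y₂ t))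
    · intro k
      exact (hcont (j+1) hj 0 k).comp (by fun_prop) (fun ξ hξ => ⟨hξ, ht⟩)
    · intro k x hx
      exact hbound (j+1) hj 0 k (x, t) ⟨hx, ht⟩
    · exact hsum j hj.le 0 (0, t) ⟨h0L, ht⟩
  have hFt : ∀ x ∈ Icc 0 L, ∀ j ≤ 4, ∀ n, ∀ t ∈ Icc 0 T,
      HasDerivWithinAt (fun τ => F j n (x, τ)) (F j (n+1) (x, t)) (Icc 0 T) t := by
    intro x hx j hj n
    refine tsum_deriv hT.le (fun k τ => term j n k (x, τ)) (fun k τ => term j (n+1) k (x, τ))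
      (u (n+1)) (hu (n+1)) ?_ ?_ ?_ ?_
    · intro k t ht
      exact (((hyd hy1C (2*k+n) t).const_mul (iteratedDerivWithin j (g k) (Icc 0 L) x)).add
        ((hyd hy2C (2*k+n) t).const_mul (iteratedDerivWithin j (h k) (Icc 0 L) x))).hasDerivWithinAt
    · intro k
      exact (hcont j hj (n+1) k).comp (by fun_prop) (fun ξ hξ => ⟨hx, hξ⟩)
    · intro k t ht
      exact hbound j hj (n+1) k (x, t) ⟨hx, ht⟩
    · exact hsum j hj n (x, 0) ⟨hx, h0T⟩
  have hw0 : ∀ x t, w x t = F 0 0 (x, t) := by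
    intro x t
    rw [hw]
    simp [F, term, wSol]
  have hw0' : ∀ t, (fun ξ => w ξ t) = fun ξ => F 0 0 (ξ, t) := fun t => funext fun x => hw0 x t
  have hj1 : ∀ j ≤ 4, ∀ x ∈ Icc 0 L, ∀ t ∈ Icc 0 T,
      iteratedDerivWithin j (fun ξ => w ξ t) (Icc 0 L) x = F j 0 (x, t) := by
    intro j hj x hx t ht
    rw [hw0']
    exact chain_iter hL (fun j ξ => F j 0 (ξ, t)) 4 (hFx t ht) j hj x hx
  have hj2 : ∀ n, ∀ j ≤ 4, ∀ q ∈ Icc 0 L ×ˢ Icc 0 T,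
      iteratedDerivWithin n (fun τ => iteratedDerivWithin j (fun ξ => w ξ τ) (Icc 0 L) q.1)
        (Icc 0 T) q.2 = F j n q := by
    intro n j hj q hq
    have e : EqOn (fun τ => iteratedDerivWithin j (fun ξ => w ξ τ) (Icc 0 L) q.1)
      (fun τ => F j 0 (q.1, τ)) (Icc 0 T) := fun t ht => hj1 j hj q.1 hq.1 t ht
    rw [iteratedDerivWithin_congr e hq.2]
    exact chain_iter hT (fun n τ => F j n (q.1, τ)) n (fun i _ => hFt q.1 hq.1 j hj i) n le_rfl
      q.2 hq.2
  refine ⟨?_, ?_, ?_, ?_⟩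
  · have := hFu 0 (by norm_num) 0
    simp only [term, iteratedDerivWithin_zero, add_zero] at this
    exact this.congr_right (fun q _ => (hw0 q.1 q.2).symm)
  · intro t ht
    rw [hw0']
    exact chain_contDiff hL (fun j ξ => F j 0 (ξ, t)) 4 (hFx t ht)
      ((hFc 4 le_rfl 0).comp (by fun_prop) (fun ξ hξ => ⟨hξ, ht⟩))
  · intro j hj x hx
    have e : ∀ t ∈ Icc 0 T, iteratedDerivWithin j (fun ξ => w ξ t) (Icc 0 L) x = F j 0 (x, t) :=
      fun t ht => hj1 j hj x hx t ht
    refine ContDiffOn.congr ?_ e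
    refine contDiffOn_infty.2 fun N => ?_
    exact chain_contDiff hT (fun n τ => F j n (x, τ)) N (fun i _ => hFt x hx j hj i)
      ((hFc j hj N).comp (by fun_prop) (fun ξ hξ => ⟨hx, hξ⟩))
  · intro n j hj
    exact ⟨(hFu j hj n).congr_right (fun q hq => (hj2 n j hj q hq).symm),
      (hFc j hj n).congr (fun q hq => hj2 n j hj q hq)⟩

/-- the series defining `w` converges uniformly on `[0,L] × [0,T]`, and for every
`m ≥ 0`, `j ∈ {0,…,4}` the termwise differentiated series converges uniformly on
`[0,L] × [0,T]` to the partial derivative `∂ₜᵐ ∂ₓʲ w`, which in particular exists (the relevant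
functions are differentiable to the stated orders) and is continuous on `[0,L] × [0,T]`. -/
theorem stmt6 (L m J : ℝ) (hL : 0 < L) (hm : 0 < m) (hJ : 0 < J)
    (ρ EI : ℝ → ℝ)
    (hρ : ContDiffOn ℝ 4 ρ (Set.Icc 0 L)) (hEI : ContDiffOn ℝ 4 EI (Set.Icc 0 L))
    (hρpos : ∃ c > 0, ∀ x ∈ Set.Icc (0:ℝ) L, c ≤ ρ x)
    (hEIpos : ∃ c > 0, ∀ x ∈ Set.Icc (0:ℝ) L, c ≤ EI x)
    (T s : ℝ) (hT : 0 < T) (hs₁ : 1 < s) (hs₂ : s < 2)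
    (y₁ y₂ : ℝ → ℝ) (hy₁ : MemGevrey s T y₁) (hy₂ : MemGevrey s T y₂)
    (w : ℝ → ℝ → ℝ) (hw : w = wSol (genG ρ EI m) (genH ρ EI J) y₁ y₂) :
    TendstoUniformlyOn
      (fun N (q : ℝ × ℝ) => ∑ k ∈ Finset.range N,
        (genG ρ EI m k q.1 * iteratedDeriv (2 * k) y₁ q.2 +
          genH ρ EI J k q.1 * iteratedDeriv (2 * k) y₂ q.2))
      (fun q => w q.1 q.2) atTop (Set.Icc 0 L ×ˢ Set.Icc 0 T) ∧
    (∀ t ∈ Set.Icc (0:ℝ) T, ContDiffOn ℝ 4 (fun ξ => w ξ t) (Set.Icc 0 L)) ∧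
    (∀ (j : ℕ), j ≤ 4 → ∀ x ∈ Set.Icc (0:ℝ) L,
      ContDiffOn ℝ (⊤ : ℕ∞)
        (fun τ => iteratedDerivWithin j (fun ξ => w ξ τ) (Set.Icc 0 L) x) (Set.Icc 0 T)) ∧
    (∀ (n : ℕ) (j : ℕ), j ≤ 4 →
      TendstoUniformlyOn
        (fun N (q : ℝ × ℝ) => ∑ k ∈ Finset.range N,
          (iteratedDerivWithin j (genG ρ EI m k) (Set.Icc 0 L) q.1 *
              iteratedDeriv (2 * k + n) y₁ q.2 +
            iteratedDerivWithin j (genH ρ EI J k) (Set.Icc 0 L) q.1 *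
              iteratedDeriv (2 * k + n) y₂ q.2))
        (fun q => iteratedDerivWithin n
            (fun τ => iteratedDerivWithin j (fun ξ => w ξ τ) (Set.Icc 0 L) q.1)
            (Set.Icc 0 T) q.2)
        atTop (Set.Icc 0 L ×ˢ Set.Icc 0 T) ∧
      ContinuousOn
        (fun q : ℝ × ℝ => iteratedDerivWithin n
            (fun τ => iteratedDerivWithin j (fun ξ => w ξ τ) (Set.Icc 0 L) q.1)
            (Set.Icc 0 T) q.2)
        (Set.Icc 0 L ×ˢ Set.Icc 0 T)) := by
  exact main_of_good hL hT hs₁ hs₂ (good_both (m := m) (J := J) hL hρ hEI hEIpos).1 (good_both (m := m) (J := J) hL hρ hEI hEIpos).2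
    hy₁ hy₂ w hw
end

section
/- Let T > 0, s ∈ (1,2) and y_1, y_2 ∈ G_s[0,T], and define w(x,t) = Σ_{k≥0} g_k(x) y_1^{(2k)}(t) + Σ_{k≥0} h_k(x) y_2^{(2k)}(t) for (x,t) ∈ [0,L]×[0,T]. Then w satisfies the Euler–Bernoulli beam equation ρ(x) w_tt(x,t) + (EI w_xx)_xx(x,t) = 0 for all x ∈ [0,L] and all t ∈ [0,T]. -/
open Set Filter intervalIntegral

namespace Beam

/-- Termwise differentiation of a series on a compact interval. -/
lemma hasDerivWithinAt_tsum_Icc {a b : ℝ} (hab : a ≤ b) (f f' : ℕ → ℝ → ℝ) (u : ℕ → ℝ)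
    (hu : Summable u) (hf : ∀ n x, HasDerivAt (f n) (f' n x) x)
    (hc : ∀ n, Continuous (f' n)) (hb : ∀ n, ∀ x ∈ Set.Icc a b, |f' n x| ≤ u n)
    (hs : Summable fun n => f n a) :
    ∀ x ∈ Set.Icc a b,
      HasDerivWithinAt (fun z => ∑' n, f n z) (∑' n, f' n x) (Set.Icc a b) x := by
  let q : ℕ → ℝ → ℝ := fun n x => f' n (Set.projIcc a b hab x)
  have hq : ∀ n, Continuous (q n) := fun n =>
    (hc n).comp (continuous_subtype_val.comp continuous_projIcc)
  let F : ℕ → ℝ → ℝ := fun n x => f n a + ∫ s in a..x, q n s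
  have hF : ∀ n x, HasDerivAt (F n) (q n x) x := fun n x =>
    ((hq n).integral_hasStrictDerivAt a x).hasDerivAt.const_add _
  have hqe : ∀ n, ∀ x ∈ Set.Icc a b, q n x = f' n x := by
    intro n x hx
    simp only [q, Set.projIcc_of_mem hab hx]
  have hFe : ∀ n, ∀ x ∈ Set.Icc a b, f n x = F n x := by
    intro n x hx
    have h1 : ∫ s in a..x, q n s = ∫ s in a..x, f' n s := by
      apply intervalIntegral.integral_congr
      intro s hs
      rw [Set.uIcc_of_le hx.1] at hs
      exact hqe n s ⟨hs.1, hs.2.trans hx.2⟩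
    have h2 : ∫ s in a..x, f' n s = f n x - f n a :=
      intervalIntegral.integral_eq_sub_of_hasDerivAt (fun y _ => hf n y)
        ((hc n).intervalIntegrable _ _)
    simp only [F]
    rw [h1, h2]; ring
  have hFa : Summable fun n => F n a := by simpa [F] using hs
  have key := hasDerivAt_tsum hu hF (fun n y => hb n _ (Set.projIcc a b hab y).2) hFa
  intro x hx
  have h := (key x).hasDerivWithinAt (s := Set.Icc a b)
  have he : (∑' n, q n x) = ∑' n, f' n x := tsum_congr fun n => hqe n x hx
  rw [he] at h
  exact h.congr (fun z hz => tsum_congr fun n => hFe n z hz) (tsum_congr fun n => hFe n x hx)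

lemma iteratedDerivWithin_two_eq {a b : ℝ} (hab : a < b) (f f1 f2 : ℝ → ℝ)
    (h1 : ∀ x ∈ Set.Icc a b, HasDerivWithinAt f (f1 x) (Set.Icc a b) x)
    (h2 : ∀ x ∈ Set.Icc a b, HasDerivWithinAt f1 (f2 x) (Set.Icc a b) x) :
    ∀ x ∈ Set.Icc a b, iteratedDerivWithin 2 f (Set.Icc a b) x = f2 x := by
  intro x hx
  have hU := uniqueDiffOn_Icc hab
  rw [show (2 : ℕ) = 1 + 1 from rfl, iteratedDerivWithin_succ, iteratedDerivWithin_one]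
  have he : Set.EqOn (derivWithin f (Set.Icc a b)) f1 (Set.Icc a b) := fun y hy =>
    (h1 y hy).derivWithin (hU y hy)
  rw [derivWithin_congr he (he hx)]
  exact (h2 x hx).derivWithin (hU x hx)

/-- Integration of a monomial bound. -/
lemma abs_integral_le {f : ℝ → ℝ} {L N : ℝ} {n : ℕ}
    (hb : ∀ x ∈ Set.Icc (0:ℝ) L, |f x| ≤ N * (x ^ n / (n.factorial : ℝ))) :
    ∀ x ∈ Set.Icc (0:ℝ) L,
      |∫ s in (0:ℝ)..x, f s| ≤ N * (x ^ (n + 1) / ((n + 1).factorial : ℝ)) := by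
  intro x hx
  have h := intervalIntegral.norm_integral_le_of_norm_le (μ := MeasureTheory.volume) (f := f)
    (g := fun s => N * (s ^ n / (n.factorial : ℝ))) hx.1
    (Filter.Eventually.of_forall fun t ht => hb t ⟨ht.1.le, ht.2.trans hx.2⟩)
    (by apply Continuous.intervalIntegrable; fun_prop)
  rw [Real.norm_eq_abs] at h
  refine h.trans (le_of_eq ?_)
  rw [intervalIntegral.integral_const_mul, intervalIntegral.integral_div, integral_pow,
    Nat.factorial_succ]
  have : (n.factorial : ℝ) ≠ 0 := by positivity
  have : (n + 1 : ℝ) ≠ 0 := by positivity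
  push_cast
  field_simp
  simp

/-- The main convergence estimate. -/
lemma summable_gevrey (K D s : ℝ) (j : ℕ) (hK : 0 ≤ K) (hD : 0 < D) (hs0 : 0 < s) (hs : s < 2)
    (hj : j ≤ 2) :
    Summable fun k : ℕ => K ^ k / ((4 * k).factorial : ℝ) *
      (D ^ (2 * (k + 2) + j + 1) * ((2 * (k + 2) + j).factorial : ℝ) ^ s) := by
  have hlim : Tendsto (fun k : ℕ => (K * D ^ 2 * (64:ℝ) ^ s) * ((k:ℝ) + 1) ^ (-(4 - 2 * s)))
      atTop (nhds 0) := by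
    have h1 : Tendsto (fun k : ℕ => (k:ℝ) + 1) atTop atTop :=
      tendsto_atTop_add_const_right _ _ tendsto_natCast_atTop_atTop
    have h2 := ((tendsto_rpow_neg_atTop (y := 4 - 2 * s) (by linarith)).comp h1).const_mul
      (K * D ^ 2 * (64:ℝ) ^ s)
    simpa using h2
  refine summable_of_ratio_norm_eventually_le (r := 1 / 2) (by norm_num) ?_
  filter_upwards [hlim.eventually_le_const (show (0:ℝ) < 1 / 2 by norm_num)] with k hk
  rw [Real.norm_of_nonneg (by positivity), Real.norm_of_nonneg (by positivity)]
  refine le_trans ?_ (mul_le_mul_of_nonneg_right hk (by positivity))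
  have e1 : (((4 * (k + 1)).factorial : ℕ) : ℝ) =
      ((4 * k + 1) * (4 * k + 2) * (4 * k + 3) * (4 * k + 4) : ℝ) * ((4 * k).factorial : ℝ) := by
    rw [show 4 * (k + 1) = 4 * k + 1 + 1 + 1 + 1 by ring]
    simp only [Nat.factorial_succ]
    push_cast; ring
  have e2 : (((2 * (k + 1 + 2) + j).factorial : ℕ) : ℝ) =
      ((2 * k + 5 + j) * (2 * k + 6 + j) : ℝ) * ((2 * (k + 2) + j).factorial : ℝ) := by
    rw [show 2 * (k + 1 + 2) + j = 2 * (k + 2) + j + 1 + 1 by ring]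
    simp only [Nat.factorial_succ]
    push_cast; ring
  have hj' : (j:ℝ) ≤ 2 := by exact_mod_cast hj
  have hk0 : (0:ℝ) ≤ k := by positivity
  have hj0 : (0:ℝ) ≤ j := by positivity
  have b1 : ((2 * k + 5 + j) * (2 * k + 6 + j) : ℝ) ≤ 64 * ((k:ℝ) + 1) ^ 2 := by nlinarith
  have b2 : ((k:ℝ) + 1) ^ 4 ≤ ((4 * k + 1) * (4 * k + 2) * (4 * k + 3) * (4 * k + 4) : ℝ) := by
    have : ((k:ℝ) + 1) ^ 4 = (k + 1) * (k + 1) * (k + 1) * (k + 1) := by ring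
    rw [this]
    gcongr <;> linarith
  have b3 : (((2 * k + 5 + j) * (2 * k + 6 + j) : ℝ)) ^ s ≤
      64 ^ s * ((k:ℝ) + 1) ^ (2 * s) := by
    refine (Real.rpow_le_rpow (by positivity) b1 hs0.le).trans (le_of_eq ?_)
    rw [Real.mul_rpow (by norm_num) (by positivity), Real.rpow_mul (by positivity)]
    norm_num
  have b4 : ((k:ℝ) + 1) ^ (2 * s) = ((k:ℝ) + 1) ^ (-(4 - 2 * s)) * ((k:ℝ) + 1) ^ 4 := by
    rw [← Real.rpow_natCast, ← Real.rpow_add (by positivity)]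
    congr 1; push_cast; ring
  rw [e1, e2, Real.mul_rpow (by positivity) (by positivity)]
  set P : ℝ := ((4 * k + 1) * (4 * k + 2) * (4 * k + 3) * (4 * k + 4) : ℝ) with hP
  set Q : ℝ := ((2 * k + 5 + j) * (2 * k + 6 + j) : ℝ) ^ s with hQ
  set Z : ℝ := ((k:ℝ) + 1) ^ (-(4 - 2 * s))
  have hPpos : 0 < P := by rw [hP]; positivity
  have hZ : 0 ≤ Z := by positivity
  have hQP : Q / P ≤ 64 ^ s * Z := by
    rw [div_le_iff₀ hPpos]
    refine b3.trans ?_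
    rw [b4, ← mul_assoc]
    gcongr
  have e3 : K ^ (k + 1) / (P * ((4 * k).factorial : ℝ)) *
      (D ^ (2 * (k + 1 + 2) + j + 1) * (Q * ((2 * (k + 2) + j).factorial : ℝ) ^ s)) =
      (K * D ^ 2) * (Q / P) * (K ^ k / ((4 * k).factorial : ℝ) *
      (D ^ (2 * (k + 2) + j + 1) * ((2 * (k + 2) + j).factorial : ℝ) ^ s)) := by
    have : ((4 * k).factorial : ℝ) ≠ 0 := by positivity
    field_simp
    ring
  rw [e3]
  have : K * D ^ 2 * (Q / P) ≤ K * D ^ 2 * 64 ^ s * Z := by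
    rw [mul_assoc _ _ Z]; gcongr
  gcongr

/-- Families of continuous functions with factorial decay on `[0,L]`. -/
def Good (L : ℝ) (F : ℕ → ℝ → ℝ) : Prop :=
  (∀ k, Continuous (F k)) ∧ ∃ M K : ℝ, 0 ≤ M ∧ 0 ≤ K ∧ ∀ k, ∀ x ∈ Set.Icc (0:ℝ) L,
    |F (k + 2) x| ≤ M * (K ^ k / ((4 * k).factorial : ℝ))

lemma Good.bound {L T s : ℝ} {F : ℕ → ℝ → ℝ} (hF : Good L F) {y : ℝ → ℝ}
    (hs0 : 0 < s) (hs : s < 2) (hy : MemGevrey s T y) (j : ℕ) (hj : j ≤ 2) :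
    ∃ u : ℕ → ℝ, Summable u ∧ ∀ k, ∀ x ∈ Set.Icc (0:ℝ) L, ∀ t ∈ Set.Icc (0:ℝ) T,
      |F k x * iteratedDeriv (2 * k + j) y t| ≤ u k := by
  obtain ⟨hc, M, K, hM, hK, hb⟩ := hF
  obtain ⟨-, D, hD, hyD⟩ := hy
  have hC : ∀ k, ∃ C, ∀ x ∈ Set.Icc (0:ℝ) L, ‖F k x‖ ≤ C := fun k =>
    isCompact_Icc.exists_bound_of_continuousOn (hc k).continuousOn
  choose C hC using hC
  let v : ℕ → ℝ := fun k => D ^ (2 * k + j + 1) * ((2 * k + j).factorial : ℝ) ^ s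
  have hv : ∀ k, 0 ≤ v k := fun k => by positivity
  let u : ℕ → ℝ := fun k => match k with
    | 0 => C 0 * v 0
    | 1 => C 1 * v 1
    | k + 2 => M * (K ^ k / ((4 * k).factorial : ℝ)) * v (k + 2)
  refine ⟨u, ?_, ?_⟩
  · rw [← summable_nat_add_iff 2]
    have := (summable_gevrey K D s j hK hD hs0 hs hj).mul_left M
    refine this.congr fun k => ?_
    simp only [u, v]; ring
  · intro k x hx t ht
    rw [abs_mul]
    have hyk := hyD (2 * k + j) t ht
    match k, hyk with
    | 0, hyk => exact mul_le_mul (hC 0 x hx) hyk (abs_nonneg _) ((norm_nonneg _).trans (hC 0 x hx))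
    | 1, hyk => exact mul_le_mul (hC 1 x hx) hyk (abs_nonneg _) ((norm_nonneg _).trans (hC 1 x hx))
    | k + 2, hyk => exact mul_le_mul (hb k x hx) hyk (abs_nonneg _) (by positivity)

/-- The series `Σ F_k(x) y^{(2k+j)}(t)`. -/
noncomputable def ser (F : ℕ → ℝ → ℝ) (y : ℝ → ℝ) (j : ℕ) (x t : ℝ) : ℝ :=
  ∑' k : ℕ, F k x * iteratedDeriv (2 * k + j) y t

lemma Good.summable {L T s : ℝ} {F : ℕ → ℝ → ℝ} (hF : Good L F) {y : ℝ → ℝ}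
    (hs0 : 0 < s) (hs : s < 2) (hy : MemGevrey s T y) (j : ℕ) (hj : j ≤ 2)
    {x t : ℝ} (hx : x ∈ Set.Icc (0:ℝ) L) (ht : t ∈ Set.Icc (0:ℝ) T) :
    Summable fun k : ℕ => F k x * iteratedDeriv (2 * k + j) y t := by
  obtain ⟨u, hu, hb⟩ := hF.bound hs0 hs hy j hj
  exact Summable.of_norm_bounded hu fun k => hb k x hx t ht

lemma ser_hasDeriv_x {L T s : ℝ} (hL : 0 < L) {F F' : ℕ → ℝ → ℝ} (hF : Good L F)
    (hF' : Good L F') (hd : ∀ k x, HasDerivAt (F k) (F' k x) x) {y : ℝ → ℝ}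
    (hs0 : 0 < s) (hs : s < 2) (hy : MemGevrey s T y) (j : ℕ) (hj : j ≤ 2)
    {t : ℝ} (ht : t ∈ Set.Icc (0:ℝ) T) :
    ∀ x ∈ Set.Icc (0:ℝ) L,
      HasDerivWithinAt (fun z => ser F y j z t) (ser F' y j x t) (Set.Icc 0 L) x := by
  obtain ⟨u, hu, hb⟩ := hF'.bound hs0 hs hy j hj
  exact hasDerivWithinAt_tsum_Icc hL.le _ (fun k x => F' k x * iteratedDeriv (2 * k + j) y t) u hu
    (fun k x => (hd k x).mul_const _) (fun k => (hF'.1 k).mul continuous_const)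
    (fun k x hx => hb k x hx t ht) (hF.summable hs0 hs hy j hj ⟨le_rfl, hL.le⟩ ht)

lemma ser_hasDeriv_t {L T s : ℝ} (hT : 0 < T) {F : ℕ → ℝ → ℝ} (hF : Good L F) {y : ℝ → ℝ}
    (hs0 : 0 < s) (hs : s < 2) (hy : MemGevrey s T y) (j : ℕ) (hj : j ≤ 1)
    {x : ℝ} (hx : x ∈ Set.Icc (0:ℝ) L) :
    ∀ t ∈ Set.Icc (0:ℝ) T,
      HasDerivWithinAt (fun z => ser F y j x z) (ser F y (j + 1) x t) (Set.Icc 0 T) t := by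
  obtain ⟨u, hu, hb⟩ := hF.bound hs0 hs hy (j + 1) (by omega)
  have hcd : ∀ n : ℕ, Continuous (iteratedDeriv n y) := fun n =>
    hy.1.continuous_iteratedDeriv n (by exact_mod_cast le_top)
  have hdd : ∀ n : ℕ, Differentiable ℝ (iteratedDeriv n y) := fun n =>
    hy.1.differentiable_iteratedDeriv n (by exact_mod_cast WithTop.coe_lt_top _)
  refine hasDerivWithinAt_tsum_Icc hT.le _
    (fun k t => F k x * iteratedDeriv (2 * k + (j + 1)) y t) u hu
    (fun k t => ?_) (fun k => continuous_const.mul (hcd _))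
    (fun k t ht => hb k x hx t ht) (hF.summable hs0 hs hy j (by omega) hx ⟨le_rfl, hT.le⟩)
  have h := (hdd (2 * k + j) t).hasDerivAt
  rw [← iteratedDeriv_succ] at h
  exact h.const_mul _

/-- One step: third derivative. -/
noncomputable def opC (r f : ℝ → ℝ) (γ : ℝ) (x : ℝ) : ℝ := γ - ∫ s in (0:ℝ)..x, r s * f s
/-- One step: bending moment. -/
noncomputable def opB (r f : ℝ → ℝ) (β γ : ℝ) (x : ℝ) : ℝ := β + ∫ s in (0:ℝ)..x, opC r f γ s
/-- One step: slope. -/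
noncomputable def opA (r e f : ℝ → ℝ) (β γ : ℝ) (x : ℝ) : ℝ :=
  ∫ s in (0:ℝ)..x, opB r f β γ s / e s
/-- One step: displacement. -/
noncomputable def opF (r e f : ℝ → ℝ) (β γ : ℝ) (x : ℝ) : ℝ := ∫ s in (0:ℝ)..x, opA r e f β γ s

/-- Abstract generating functions. -/
noncomputable def phi (r e f0 : ℝ → ℝ) (β γ : ℝ) : ℕ → ℝ → ℝ
  | 0 => f0
  | 1 => opF r e f0 β γ
  | (k + 2) => opF r e (phi r e f0 β γ (k + 1)) 0 0

/-- First derivatives. -/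
noncomputable def phiA (r e f0 : ℝ → ℝ) (α β γ : ℝ) : ℕ → ℝ → ℝ
  | 0 => fun _ => α
  | 1 => opA r e f0 β γ
  | (k + 2) => opA r e (phi r e f0 β γ (k + 1)) 0 0

/-- Moments. -/
noncomputable def phiB (r e f0 : ℝ → ℝ) (β γ : ℝ) : ℕ → ℝ → ℝ
  | 0 => fun _ => 0
  | 1 => opB r f0 β γ
  | (k + 2) => opB r (phi r e f0 β γ (k + 1)) 0 0

/-- Derivatives of moments. -/
noncomputable def phiC (r e f0 : ℝ → ℝ) (β γ : ℝ) : ℕ → ℝ → ℝ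
  | 0 => fun _ => 0
  | 1 => opC r f0 γ
  | (k + 2) => opC r (phi r e f0 β γ (k + 1)) 0

/-- Second derivatives of moments. -/
noncomputable def phiD (r e f0 : ℝ → ℝ) (β γ : ℝ) : ℕ → ℝ → ℝ
  | 0 => fun _ => 0
  | (k + 1) => fun x => -(r x * phi r e f0 β γ k x)

section
variable {r e f : ℝ → ℝ}

lemma hasDerivAt_opC (hr : Continuous r) (hf : Continuous f) (γ x : ℝ) :
    HasDerivAt (opC r f γ) (-(r x * f x)) x :=
  ((hr.mul hf).integral_hasStrictDerivAt 0 x).hasDerivAt.const_sub γ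

lemma continuous_opC (hr : Continuous r) (hf : Continuous f) (γ : ℝ) : Continuous (opC r f γ) :=
  continuous_iff_continuousAt.2 fun x => (hasDerivAt_opC hr hf γ x).continuousAt

lemma hasDerivAt_opB (hr : Continuous r) (hf : Continuous f) (β γ x : ℝ) :
    HasDerivAt (opB r f β γ) (opC r f γ x) x :=
  ((continuous_opC hr hf γ).integral_hasStrictDerivAt 0 x).hasDerivAt.const_add β

lemma continuous_opB (hr : Continuous r) (hf : Continuous f) (β γ : ℝ) :
    Continuous (opB r f β γ) :=
  continuous_iff_continuousAt.2 fun x => (hasDerivAt_opB hr hf β γ x).continuousAt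

lemma hasDerivAt_opA (hr : Continuous r) (he : Continuous e) (he0 : ∀ x, e x ≠ 0)
    (hf : Continuous f) (β γ x : ℝ) :
    HasDerivAt (opA r e f β γ) (opB r f β γ x / e x) x :=
  (((continuous_opB hr hf β γ).div he he0).integral_hasStrictDerivAt 0 x).hasDerivAt

lemma continuous_opA (hr : Continuous r) (he : Continuous e) (he0 : ∀ x, e x ≠ 0)
    (hf : Continuous f) (β γ : ℝ) : Continuous (opA r e f β γ) :=
  continuous_iff_continuousAt.2 fun x => (hasDerivAt_opA hr he he0 hf β γ x).continuousAt

lemma hasDerivAt_opF (hr : Continuous r) (he : Continuous e) (he0 : ∀ x, e x ≠ 0)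
    (hf : Continuous f) (β γ x : ℝ) :
    HasDerivAt (opF r e f β γ) (opA r e f β γ x) x :=
  ((continuous_opA hr he he0 hf β γ).integral_hasStrictDerivAt 0 x).hasDerivAt

lemma continuous_opF (hr : Continuous r) (he : Continuous e) (he0 : ∀ x, e x ≠ 0)
    (hf : Continuous f) (β γ : ℝ) : Continuous (opF r e f β γ) :=
  continuous_iff_continuousAt.2 fun x => (hasDerivAt_opF hr he he0 hf β γ x).continuousAt

/-- Bounds for one step. -/
lemma op_bounds {L N R E : ℝ} {n : ℕ} (hR : 0 ≤ R) (hE : 0 ≤ E)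
    (hrR : ∀ x, |r x| ≤ R) (heE : ∀ x, |(e x)⁻¹| ≤ E)
    (hb : ∀ x ∈ Set.Icc (0:ℝ) L, |f x| ≤ N * (x ^ n / (n.factorial : ℝ))) :
    ∀ x ∈ Set.Icc (0:ℝ) L,
      |r x * f x| ≤ R * N * (x ^ n / (n.factorial : ℝ)) ∧
      |opC r f 0 x| ≤ R * N * (x ^ (n + 1) / ((n + 1).factorial : ℝ)) ∧
      |opB r f 0 0 x| ≤ R * N * (x ^ (n + 2) / ((n + 2).factorial : ℝ)) ∧
      |opB r f 0 0 x / e x| ≤ E * (R * N) * (x ^ (n + 2) / ((n + 2).factorial : ℝ)) ∧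
      |opA r e f 0 0 x| ≤ E * (R * N) * (x ^ (n + 3) / ((n + 3).factorial : ℝ)) ∧
      |opF r e f 0 0 x| ≤ E * (R * N) * (x ^ (n + 4) / ((n + 4).factorial : ℝ)) := by
  have h0 : ∀ x ∈ Set.Icc (0:ℝ) L, |r x * f x| ≤ R * N * (x ^ n / (n.factorial : ℝ)) := by
    intro x hx
    rw [abs_mul, mul_assoc]
    exact mul_le_mul (hrR x) (hb x hx) (abs_nonneg _) hR
  have h1 : ∀ x ∈ Set.Icc (0:ℝ) L,
      |opC r f 0 x| ≤ R * N * (x ^ (n + 1) / ((n + 1).factorial : ℝ)) := by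
    intro x hx
    rw [opC, zero_sub, abs_neg]
    exact abs_integral_le h0 x hx
  have h2 : ∀ x ∈ Set.Icc (0:ℝ) L,
      |opB r f 0 0 x| ≤ R * N * (x ^ (n + 2) / ((n + 2).factorial : ℝ)) := by
    intro x hx
    rw [opB, zero_add]
    exact abs_integral_le h1 x hx
  have h3 : ∀ x ∈ Set.Icc (0:ℝ) L,
      |opB r f 0 0 x / e x| ≤ E * (R * N) * (x ^ (n + 2) / ((n + 2).factorial : ℝ)) := by
    intro x hx
    rw [div_eq_inv_mul, abs_mul, mul_assoc]
    exact mul_le_mul (heE x) (h2 x hx) (abs_nonneg _) hE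
  have h4 : ∀ x ∈ Set.Icc (0:ℝ) L,
      |opA r e f 0 0 x| ≤ E * (R * N) * (x ^ (n + 3) / ((n + 3).factorial : ℝ)) :=
    fun x hx => abs_integral_le h3 x hx
  have h5 : ∀ x ∈ Set.Icc (0:ℝ) L,
      |opF r e f 0 0 x| ≤ E * (R * N) * (x ^ (n + 4) / ((n + 4).factorial : ℝ)) :=
    fun x hx => abs_integral_le h4 x hx
  exact fun x hx => ⟨h0 x hx, h1 x hx, h2 x hx, h3 x hx, h4 x hx, h5 x hx⟩

end

section
variable {r e f0 : ℝ → ℝ} {α β γ : ℝ}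

lemma continuous_phi (hr : Continuous r) (he : Continuous e) (he0 : ∀ x, e x ≠ 0)
    (hf : Continuous f0) : ∀ k, Continuous (phi r e f0 β γ k)
  | 0 => hf
  | 1 => continuous_opF hr he he0 hf β γ
  | (k + 2) => continuous_opF hr he he0 (continuous_phi hr he he0 hf (k + 1)) 0 0

lemma hasDerivAt_phi (hr : Continuous r) (he : Continuous e) (he0 : ∀ x, e x ≠ 0)
    (hf : ∀ x, HasDerivAt f0 α x) (k : ℕ) (x : ℝ) :
    HasDerivAt (phi r e f0 β γ k) (phiA r e f0 α β γ k x) x ∧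
    HasDerivAt (phiA r e f0 α β γ k) (phiB r e f0 β γ k x / e x) x ∧
    HasDerivAt (phiB r e f0 β γ k) (phiC r e f0 β γ k x) x ∧
    HasDerivAt (phiC r e f0 β γ k) (phiD r e f0 β γ k x) x := by
  have hf' : Continuous f0 := continuous_iff_continuousAt.2 fun x => (hf x).continuousAt
  match k with
  | 0 =>
    refine ⟨hf x, ?_, hasDerivAt_const _ _, hasDerivAt_const _ _⟩
    simp only [phiB, zero_div]
    exact hasDerivAt_const _ _
  | 1 => exact ⟨hasDerivAt_opF hr he he0 hf' β γ x, hasDerivAt_opA hr he he0 hf' β γ x,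
      hasDerivAt_opB hr hf' β γ x, hasDerivAt_opC hr hf' γ x⟩
  | k + 2 =>
    have h := continuous_phi (β := β) (γ := γ) hr he he0 hf' (k + 1)
    exact ⟨hasDerivAt_opF hr he he0 h 0 0 x, hasDerivAt_opA hr he he0 h 0 0 x,
      hasDerivAt_opB hr h 0 0 x, hasDerivAt_opC hr h 0 x⟩

lemma phi_bound {L R E M : ℝ} (hR : 0 ≤ R) (hE : 0 ≤ E)
    (hrR : ∀ x, |r x| ≤ R) (heE : ∀ x, |(e x)⁻¹| ≤ E)
    (hM : ∀ x ∈ Set.Icc (0:ℝ) L, |phi r e f0 β γ 1 x| ≤ M) :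
    ∀ k : ℕ, ∀ x ∈ Set.Icc (0:ℝ) L, |phi r e f0 β γ (k + 1) x| ≤
      M * (E * R) ^ k * (x ^ (4 * k) / ((4 * k).factorial : ℝ)) := by
  intro k
  induction k with
  | zero => intro x hx; simpa using hM x hx
  | succ k ih =>
    intro x hx
    have h := (op_bounds hR hE hrR heE ih x hx).2.2.2.2.2
    rw [show 4 * (k + 1) = 4 * k + 4 by ring]
    refine h.trans (le_of_eq ?_)
    ring

lemma good_all {L : ℝ} (hL : 0 < L) (hr : Continuous r) (he : Continuous e)
    (he0 : ∀ x, e x ≠ 0) (hf : ∀ x, HasDerivAt f0 α x) {R E : ℝ} (hR : 0 ≤ R) (hE : 1 ≤ E)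
    (hrR : ∀ x, |r x| ≤ R) (heE : ∀ x, |(e x)⁻¹| ≤ E) :
    Good L (phi r e f0 β γ) ∧ Good L (phiA r e f0 α β γ) ∧ Good L (phiB r e f0 β γ) ∧
    Good L (fun k x => phiB r e f0 β γ k x / e x) ∧ Good L (phiC r e f0 β γ) ∧
    Good L (phiD r e f0 β γ) := by
  have hf' : Continuous f0 := continuous_iff_continuousAt.2 fun x => (hf x).continuousAt
  have hE0 : 0 ≤ E := by linarith
  have hcp : ∀ k, Continuous (phi r e f0 β γ k) := continuous_phi hr he he0 hf'
  have hd := hasDerivAt_phi (β := β) (γ := γ) hr he he0 hf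
  have hcB : ∀ k, Continuous (phiB r e f0 β γ k) := fun k =>
    continuous_iff_continuousAt.2 fun x => (hd k x).2.2.1.continuousAt
  have hcD : ∀ k, Continuous (phiD r e f0 β γ k) := fun k => by
    match k with
    | 0 => exact continuous_const
    | k + 1 => exact (hr.mul (hcp k)).neg
  obtain ⟨M, hM⟩ := isCompact_Icc.exists_bound_of_continuousOn (s := Set.Icc (0:ℝ) L)
    (hcp 1).continuousOn
  have hM0 : 0 ≤ M := (norm_nonneg _).trans (hM 0 ⟨le_rfl, hL.le⟩)
  have hb := phi_bound hR hE0 hrR heE hM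
  have key : ∀ k : ℕ, ∀ i ≤ 4, ∀ A, 0 ≤ A → A ≤ E → ∀ x ∈ Set.Icc (0:ℝ) L,
      A * (R * (M * (E * R) ^ k)) * (x ^ (4 * k + i) / ((4 * k + i).factorial : ℝ)) ≤
      (E * R * M * (1 + L) ^ 4) * ((E * R * (1 + L) ^ 4) ^ k / ((4 * k).factorial : ℝ)) := by
    intro k i hi A hA hAE x hx
    have h1 : x ^ (4 * k + i) ≤ (1 + L) ^ (4 * k + 4) :=
      (pow_le_pow_left₀ hx.1 (by linarith [hx.2]) _).trans
        (pow_le_pow_right₀ (by linarith) (by omega))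
    have h2 : ((4 * k).factorial : ℝ) ≤ ((4 * k + i).factorial : ℝ) := by
      exact_mod_cast Nat.factorial_le (by omega)
    have hx0 := hx.1
    calc A * (R * (M * (E * R) ^ k)) * (x ^ (4 * k + i) / ((4 * k + i).factorial : ℝ))
        ≤ E * (R * (M * (E * R) ^ k)) * ((1 + L) ^ (4 * k + 4) / ((4 * k).factorial : ℝ)) := by
          gcongr
      _ = _ := by
          rw [pow_add, pow_mul, mul_pow (E * R)]
          generalize (1 + L) ^ 4 = Z
          ring
  have all : ∀ k : ℕ, ∀ x ∈ Set.Icc (0:ℝ) L, _ := fun k x hx =>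
    op_bounds hR hE0 hrR heE (hb k) x hx
  have mk : ∀ F : ℕ → ℝ → ℝ, (∀ k, Continuous (F k)) →
      (∀ k : ℕ, ∀ x ∈ Set.Icc (0:ℝ) L, |F (k + 2) x| ≤
        (E * R * M * (1 + L) ^ 4) * ((E * R * (1 + L) ^ 4) ^ k / ((4 * k).factorial : ℝ))) →
      Good L F := fun F h1 h2 => ⟨h1, _, _, by positivity, by positivity, h2⟩
  have one : ∀ z : ℝ, R * z = 1 * (R * z) := fun z => (one_mul _).symm
  refine ⟨mk _ hcp fun k x hx => ?_, mk _ (fun k => continuous_iff_continuousAt.2 fun x =>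
    (hd k x).2.1.continuousAt) fun k x hx => ?_, mk _ hcB fun k x hx => ?_,
    mk _ (fun k => (hcB k).div he he0) fun k x hx => ?_, mk _ (fun k =>
      continuous_iff_continuousAt.2 fun x => (hd k x).2.2.2.continuousAt) fun k x hx => ?_,
    mk _ hcD fun k x hx => ?_⟩
  · exact (all k x hx).2.2.2.2.2.trans (key k 4 (by norm_num) E hE0 le_rfl x hx)
  · exact (all k x hx).2.2.2.2.1.trans (key k 3 (by norm_num) E hE0 le_rfl x hx)
  · refine (all k x hx).2.2.1.trans ?_
    rw [one]
    exact key k 2 (by norm_num) 1 zero_le_one hE x hx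
  · exact (all k x hx).2.2.2.1.trans (key k 2 (by norm_num) E hE0 le_rfl x hx)
  · refine (all k x hx).2.1.trans ?_
    rw [one]
    exact key k 1 (by norm_num) 1 zero_le_one hE x hx
  · simp only [phiD, abs_neg]
    refine (all k x hx).1.trans ?_
    rw [one]
    exact key k 0 (by norm_num) 1 zero_le_one hE x hx

lemma ser_phiD {L T s : ℝ} (hD : Good L (phiD r e f0 β γ)) {y : ℝ → ℝ}
    (hs0 : 0 < s) (hs : s < 2) (hy : MemGevrey s T y)
    {x t : ℝ} (hx : x ∈ Set.Icc (0:ℝ) L) (ht : t ∈ Set.Icc (0:ℝ) T) :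
    ser (phiD r e f0 β γ) y 0 x t = -(r x * ser (phi r e f0 β γ) y 2 x t) := by
  have h := hD.summable hs0 hs hy 0 (by norm_num) hx ht
  rw [ser, h.tsum_eq_zero_add, ser, ← tsum_mul_left, ← tsum_neg]
  simp only [phiD, zero_mul, zero_add]
  refine tsum_congr fun k => ?_
  rw [show 2 * (k + 1) + 0 = 2 * k + 2 by ring]
  ring

end

/-- Congruence for integrals starting at `0` on `[0,L]`. -/
lemma int_congr {L : ℝ} {p q : ℝ → ℝ} (h : ∀ x ∈ Set.Icc (0:ℝ) L, p x = q x) :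
    ∀ x ∈ Set.Icc (0:ℝ) L, ∫ s in (0:ℝ)..x, p s = ∫ s in (0:ℝ)..x, q s := by
  intro x hx
  apply intervalIntegral.integral_congr
  intro s hs
  rw [Set.uIcc_of_le hx.1] at hs
  exact h s ⟨hs.1, hs.2.trans hx.2⟩

lemma continuous_int {p : ℝ → ℝ} (hp : Continuous p) :
    Continuous fun x => ∫ s in (0:ℝ)..x, p s :=
  continuous_iff_continuousAt.2 fun x =>
    (hp.integral_hasStrictDerivAt 0 x).hasDerivAt.continuousAt

lemma int_lin {p q u : ℝ → ℝ} (hp : Continuous p) (hq : Continuous q) (hu : Continuous u)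
    {β γ x : ℝ} :
    (∫ s in (0:ℝ)..x, (-p s + γ * q s + β * u s)) =
      -(∫ s in (0:ℝ)..x, p s) + γ * (∫ s in (0:ℝ)..x, q s) + β * (∫ s in (0:ℝ)..x, u s) := by
  have h1 : Continuous fun s => -p s := hp.neg
  have h2 : Continuous fun s => γ * q s := hq.const_mul γ
  have h3 : Continuous fun s => β * u s := hu.const_mul β
  have h12 : Continuous fun s => -p s + γ * q s := h1.add h2
  rw [intervalIntegral.integral_add (h12.intervalIntegrable _ _)
      (h3.intervalIntegrable _ _), intervalIntegral.integral_add (h1.intervalIntegrable _ _)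
      (h2.intervalIntegrable _ _), intervalIntegral.integral_neg,
    intervalIntegral.integral_const_mul, intervalIntegral.integral_const_mul]

lemma opF_expand {r e f : ℝ → ℝ} (hr : Continuous r) (he : Continuous e) (he0 : ∀ x, e x ≠ 0)
    (hf : Continuous f) (β γ x : ℝ) :
    opF r e f β γ x =
      -(∫ s₁ in (0:ℝ)..x, ∫ s₂ in (0:ℝ)..s₁,
          (∫ s₃ in (0:ℝ)..s₂, ∫ s₄ in (0:ℝ)..s₃, r s₄ * f s₄) / e s₂)
      + γ * (∫ s₁ in (0:ℝ)..x, ∫ s₂ in (0:ℝ)..s₁, s₂ / e s₂)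
      + β * (∫ s₁ in (0:ℝ)..x, ∫ s₂ in (0:ℝ)..s₁, 1 / e s₂) := by
  have c1 : Continuous fun s => ∫ s₄ in (0:ℝ)..s, r s₄ * f s₄ := continuous_int (hr.mul hf)
  have c2 := continuous_int c1
  have c3 : Continuous fun s₂ =>
      (∫ s₃ in (0:ℝ)..s₂, ∫ s₄ in (0:ℝ)..s₃, r s₄ * f s₄) / e s₂ := c2.div he he0
  have c4 : Continuous fun s₂ => s₂ / e s₂ := continuous_id.div he he0
  have c5 : Continuous fun s₂ => 1 / e s₂ := continuous_const.div he he0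
  have hB : ∀ s, opB r f β γ s =
      β + γ * s - ∫ s₃ in (0:ℝ)..s, ∫ s₄ in (0:ℝ)..s₃, r s₄ * f s₄ := by
    intro s
    simp only [opB, opC]
    rw [intervalIntegral.integral_sub (continuous_const.intervalIntegrable _ _)
      (c1.intervalIntegrable _ _)]
    simp; ring
  have hA : ∀ s, opA r e f β γ s =
      -(∫ s₂ in (0:ℝ)..s, (∫ s₃ in (0:ℝ)..s₂, ∫ s₄ in (0:ℝ)..s₃, r s₄ * f s₄) / e s₂)
      + γ * (∫ s₂ in (0:ℝ)..s, s₂ / e s₂) + β * (∫ s₂ in (0:ℝ)..s, 1 / e s₂) := by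
    intro s
    rw [← int_lin c3 c4 c5, opA]
    congr 1
    funext z
    rw [hB]
    ring
  have d3 := continuous_int c3
  have d4 := continuous_int c4
  have d5 := continuous_int c5
  rw [← int_lin d3 d4 d5, opF]
  congr 1
  funext z
  rw [hA]

lemma quad_congr {L : ℝ} {EI e p q : ℝ → ℝ} (hE : ∀ x ∈ Set.Icc (0:ℝ) L, EI x = e x)
    (hpq : ∀ x ∈ Set.Icc (0:ℝ) L, p x = q x) :
    ∀ x ∈ Set.Icc (0:ℝ) L,
      (∫ s₁ in (0:ℝ)..x, ∫ s₂ in (0:ℝ)..s₁, ∫ s₃ in (0:ℝ)..s₂, ∫ s₄ in (0:ℝ)..s₃,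
        p s₄ / EI s₂) =
      ∫ s₁ in (0:ℝ)..x, ∫ s₂ in (0:ℝ)..s₁,
        (∫ s₃ in (0:ℝ)..s₂, ∫ s₄ in (0:ℝ)..s₃, q s₄) / e s₂ := by
  refine int_congr (int_congr fun s₂ h₂ => ?_)
  simp only [intervalIntegral.integral_div]
  rw [hE s₂ h₂, int_congr (int_congr hpq) s₂ h₂]

lemma genG_eq {L m : ℝ} {ρ EI r e : ℝ → ℝ} (hr : Continuous r) (he : Continuous e)
    (he0 : ∀ x, e x ≠ 0) (hρ : ∀ x ∈ Set.Icc (0:ℝ) L, ρ x = r x)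
    (hE : ∀ x ∈ Set.Icc (0:ℝ) L, EI x = e x) :
    ∀ k, ∀ x ∈ Set.Icc (0:ℝ) L, genG ρ EI m k x = phi r e (fun _ => 1) 0 (-m) k x
  | 0 => fun x _ => rfl
  | 1 => fun x hx => by
    rw [genG, phi, opF_expand hr he he0 continuous_const]
    beta_reduce
    rw [quad_congr hE (p := ρ) (q := fun s => r s * 1) (fun y hy => by rw [hρ y hy, mul_one]) x hx]
    have : (∫ s₁ in (0:ℝ)..x, ∫ s₂ in (0:ℝ)..s₁, ∫ _s₃ in (0:ℝ)..s₂, 1 / EI s₂) =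
        ∫ s₁ in (0:ℝ)..x, ∫ s₂ in (0:ℝ)..s₁, s₂ / e s₂ := by
      refine int_congr (int_congr fun s₂ h₂ => ?_) x hx
      rw [hE s₂ h₂]
      simp [div_eq_mul_inv]
    rw [this]
    ring
  | (k + 2) => fun x hx => by
    have hc := continuous_phi (β := 0) (γ := -m) (f0 := fun _ => 1) hr he he0 continuous_const
      (k + 1)
    rw [genG, phi, opF_expand hr he he0 hc]
    beta_reduce
    rw [quad_congr hE (p := fun s => ρ s * genG ρ EI m (k + 1) s) (q := fun s => r s * phi r e (fun _ => 1) 0 (-m) (k + 1) s)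
        (fun y hy => by rw [hρ y hy, genG_eq hr he he0 hρ hE (k + 1) y hy]) x hx]
    ring

lemma genH_eq {L J : ℝ} {ρ EI r e : ℝ → ℝ} (hr : Continuous r) (he : Continuous e)
    (he0 : ∀ x, e x ≠ 0) (hρ : ∀ x ∈ Set.Icc (0:ℝ) L, ρ x = r x)
    (hE : ∀ x ∈ Set.Icc (0:ℝ) L, EI x = e x) :
    ∀ k, ∀ x ∈ Set.Icc (0:ℝ) L, genH ρ EI J k x = phi r e (fun x => x) J 0 k x
  | 0 => fun x _ => rfl
  | 1 => fun x hx => by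
    rw [genH, phi, opF_expand hr he he0 continuous_id']
    beta_reduce
    rw [quad_congr hE (p := fun s => s * ρ s) (q := fun s => r s * s) (fun y hy => by rw [hρ y hy, mul_comm]) x hx]
    have : (∫ s₁ in (0:ℝ)..x, ∫ s₂ in (0:ℝ)..s₁, 1 / EI s₂) =
        ∫ s₁ in (0:ℝ)..x, ∫ s₂ in (0:ℝ)..s₁, 1 / e s₂ := by
      refine int_congr (int_congr fun s₂ h₂ => ?_) x hx
      rw [hE s₂ h₂]
    rw [this]
    ring
  | (k + 2) => fun x hx => by
    have hc := continuous_phi (β := J) (γ := 0) (f0 := fun x => x) hr he he0 continuous_id'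
      (k + 1)
    rw [genH, phi, opF_expand hr he he0 hc]
    beta_reduce
    rw [quad_congr hE (p := fun s => ρ s * genH ρ EI J (k + 1) s) (q := fun s => r s * phi r e (fun x => x) J 0 (k + 1) s)
        (fun y hy => by rw [hρ y hy, genH_eq hr he he0 hρ hE (k + 1) y hy]) x hx]
    ring

end Beam

/-- `w` satisfies the Euler–Bernoulli beam equation
`ρ(x) w_tt(x,t) + (EI w_xx)_xx(x,t) = 0` for all `x ∈ [0,L]` and `t ∈ [0,T]`. -/
theorem stmt7 (L m J : ℝ) (hL : 0 < L) (hm : 0 < m) (hJ : 0 < J)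
    (ρ EI : ℝ → ℝ)
    (hρ : ContDiffOn ℝ 4 ρ (Set.Icc 0 L)) (hEI : ContDiffOn ℝ 4 EI (Set.Icc 0 L))
    (hρpos : ∃ c > 0, ∀ x ∈ Set.Icc (0:ℝ) L, c ≤ ρ x)
    (hEIpos : ∃ c > 0, ∀ x ∈ Set.Icc (0:ℝ) L, c ≤ EI x)
    (T s : ℝ) (hT : 0 < T) (hs₁ : 1 < s) (hs₂ : s < 2)
    (y₁ y₂ : ℝ → ℝ) (hy₁ : MemGevrey s T y₁) (hy₂ : MemGevrey s T y₂)
    (w : ℝ → ℝ → ℝ) (hw : w = wSol (genG ρ EI m) (genH ρ EI J) y₁ y₂) :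
    ∀ x ∈ Set.Icc (0:ℝ) L, ∀ t ∈ Set.Icc (0:ℝ) T,
      ρ x * iteratedDerivWithin 2 (fun τ => w x τ) (Set.Icc 0 T) t +
        iteratedDerivWithin 2
          (fun ξ => EI ξ * iteratedDerivWithin 2 (fun ξ' => w ξ' t) (Set.Icc 0 L) ξ)
          (Set.Icc 0 L) x = 0 := by
  obtain ⟨c, hc, hEc⟩ := hEIpos
  have hs0 : 0 < s := by linarith
  let pr : ℝ → ℝ := fun x => Set.projIcc 0 L hL.le x
  have hpr : Continuous pr := continuous_subtype_val.comp continuous_projIcc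
  have hprm : ∀ x, pr x ∈ Set.Icc (0:ℝ) L := fun x => (Set.projIcc 0 L hL.le x).2
  have hpre : ∀ x ∈ Set.Icc (0:ℝ) L, pr x = x := fun x hx => by
    simp only [pr, Set.projIcc_of_mem hL.le hx]
  let r : ℝ → ℝ := fun x => ρ (pr x)
  let e : ℝ → ℝ := fun x => EI (pr x)
  have hr : Continuous r := hρ.continuousOn.comp_continuous hpr hprm
  have he : Continuous e := hEI.continuousOn.comp_continuous hpr hprm
  have hre : ∀ x ∈ Set.Icc (0:ℝ) L, ρ x = r x := fun x hx => by simp only [r, hpre x hx]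
  have hee : ∀ x ∈ Set.Icc (0:ℝ) L, EI x = e x := fun x hx => by simp only [e, hpre x hx]
  have hec : ∀ x, c ≤ e x := fun x => hEc _ (hprm x)
  have hepos : ∀ x, 0 < e x := fun x => hc.trans_le (hec x)
  have he0 : ∀ x, e x ≠ 0 := fun x => (hepos x).ne'
  obtain ⟨R, hR⟩ := isCompact_Icc.exists_bound_of_continuousOn hρ.continuousOn
  have hrR : ∀ x, |r x| ≤ R := fun x => hR _ (hprm x)
  have hR0 : 0 ≤ R := (abs_nonneg _).trans (hrR 0)
  have heE : ∀ x, |(e x)⁻¹| ≤ max 1 c⁻¹ := fun x => by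
    rw [abs_of_pos (inv_pos.2 (hepos x))]
    exact (inv_anti₀ hc (hec x)).trans (le_max_right _ _)
  have hf1 : ∀ x : ℝ, HasDerivAt (fun _ : ℝ => (1:ℝ)) 0 x := fun x => hasDerivAt_const _ _
  have hf2 : ∀ x : ℝ, HasDerivAt (fun x : ℝ => x) 1 x := fun x => hasDerivAt_id' _
  obtain ⟨gF, gA, gB, gBe, gC, gD⟩ := Beam.good_all (β := 0) (γ := -m) hL hr he he0 hf1 hR0
    (le_max_left _ _) hrR heE
  obtain ⟨kF, kA, kB, kBe, kC, kD⟩ := Beam.good_all (β := J) (γ := 0) hL hr he he0 hf2 hR0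
    (le_max_left _ _) hrR heE
  have gd := Beam.hasDerivAt_phi (β := 0) (γ := -m) hr he he0 hf1
  have kd := Beam.hasDerivAt_phi (β := J) (γ := 0) hr he he0 hf2
  set gf := Beam.phi r e (fun _ => 1) 0 (-m) with hgf
  set kf := Beam.phi r e (fun x => x) J 0 with hkf
  have hwe : ∀ x ∈ Set.Icc (0:ℝ) L, ∀ t ∈ Set.Icc (0:ℝ) T,
      w x t = Beam.ser gf y₁ 0 x t + Beam.ser kf y₂ 0 x t := by
    intro x hx t ht
    rw [hw, Beam.ser, Beam.ser,
      ← (gF.summable hs0 hs₂ hy₁ 0 (by norm_num) hx ht).tsum_add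
        (kF.summable hs0 hs₂ hy₂ 0 (by norm_num) hx ht)]
    refine tsum_congr fun k => ?_
    rw [Beam.genG_eq hr he he0 hre hee k x hx, Beam.genH_eq hr he he0 hre hee k x hx]
    rfl
  intro x hx t ht
  -- time derivatives
  have htt : iteratedDerivWithin 2 (fun τ => w x τ) (Set.Icc 0 T) t =
      Beam.ser gf y₁ 2 x t + Beam.ser kf y₂ 2 x t := by
    refine Beam.iteratedDerivWithin_two_eq hT _
      (fun τ => Beam.ser gf y₁ 1 x τ + Beam.ser kf y₂ 1 x τ)
      (fun τ => Beam.ser gf y₁ 2 x τ + Beam.ser kf y₂ 2 x τ) ?_ ?_ t ht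
    · intro τ hτ
      exact ((Beam.ser_hasDeriv_t hT gF hs0 hs₂ hy₁ 0 (by norm_num) hx τ hτ).add
        (Beam.ser_hasDeriv_t hT kF hs0 hs₂ hy₂ 0 (by norm_num) hx τ hτ)).congr
        (fun z hz => hwe x hx z hz) (hwe x hx τ hτ)
    · intro τ hτ
      exact (Beam.ser_hasDeriv_t hT gF hs0 hs₂ hy₁ 1 le_rfl hx τ hτ).add
        (Beam.ser_hasDeriv_t hT kF hs0 hs₂ hy₂ 1 le_rfl hx τ hτ)
  -- second space derivative
  have hxx : ∀ ξ ∈ Set.Icc (0:ℝ) L,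
      iteratedDerivWithin 2 (fun ξ' => w ξ' t) (Set.Icc 0 L) ξ =
      Beam.ser (fun k x => Beam.phiB r e (fun _ => 1) 0 (-m) k x / e x) y₁ 0 ξ t +
      Beam.ser (fun k x => Beam.phiB r e (fun x => x) J 0 k x / e x) y₂ 0 ξ t := by
    refine Beam.iteratedDerivWithin_two_eq hL _
      (fun ξ => Beam.ser (Beam.phiA r e (fun _ => 1) 0 0 (-m)) y₁ 0 ξ t +
        Beam.ser (Beam.phiA r e (fun x => x) 1 J 0) y₂ 0 ξ t) (fun ξ => _) ?_ ?_
    · intro ξ hξ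
      exact ((Beam.ser_hasDeriv_x hL gF gA (fun k x => (gd k x).1) hs0 hs₂ hy₁ 0 (by norm_num)
        ht ξ hξ).add (Beam.ser_hasDeriv_x hL kF kA (fun k x => (kd k x).1) hs0 hs₂ hy₂ 0
        (by norm_num) ht ξ hξ)).congr (fun z hz => hwe z hz t ht) (hwe ξ hξ t ht)
    · intro ξ hξ
      exact (Beam.ser_hasDeriv_x hL gA gBe (fun k x => (gd k x).2.1) hs0 hs₂ hy₁ 0 (by norm_num)
        ht ξ hξ).add (Beam.ser_hasDeriv_x hL kA kBe (fun k x => (kd k x).2.1) hs0 hs₂ hy₂ 0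
        (by norm_num) ht ξ hξ)
  have hdiv : ∀ (F : ℕ → ℝ → ℝ) (y : ℝ → ℝ) (ξ : ℝ),
      e ξ * Beam.ser (fun k x => F k x / e x) y 0 ξ t = Beam.ser F y 0 ξ t := by
    intro F y ξ
    rw [Beam.ser, Beam.ser, ← tsum_mul_left]
    refine tsum_congr fun k => ?_
    have := he0 ξ
    field_simp
  have hmom : ∀ ξ ∈ Set.Icc (0:ℝ) L,
      EI ξ * iteratedDerivWithin 2 (fun ξ' => w ξ' t) (Set.Icc 0 L) ξ =
      Beam.ser (Beam.phiB r e (fun _ => 1) 0 (-m)) y₁ 0 ξ t +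
      Beam.ser (Beam.phiB r e (fun x => x) J 0) y₂ 0 ξ t := by
    intro ξ hξ
    rw [hxx ξ hξ, hee ξ hξ, mul_add, hdiv, hdiv]
  have hxxxx : iteratedDerivWithin 2
      (fun ξ => EI ξ * iteratedDerivWithin 2 (fun ξ' => w ξ' t) (Set.Icc 0 L) ξ)
      (Set.Icc 0 L) x =
      Beam.ser (Beam.phiD r e (fun _ => 1) 0 (-m)) y₁ 0 x t +
      Beam.ser (Beam.phiD r e (fun x => x) J 0) y₂ 0 x t := by
    refine Beam.iteratedDerivWithin_two_eq hL _
      (fun ξ => Beam.ser (Beam.phiC r e (fun _ => 1) 0 (-m)) y₁ 0 ξ t +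
        Beam.ser (Beam.phiC r e (fun x => x) J 0) y₂ 0 ξ t)
      (fun ξ => Beam.ser (Beam.phiD r e (fun _ => 1) 0 (-m)) y₁ 0 ξ t +
        Beam.ser (Beam.phiD r e (fun x => x) J 0) y₂ 0 ξ t) ?_ ?_ x hx
    · intro ξ hξ
      exact ((Beam.ser_hasDeriv_x hL gB gC (fun k x => (gd k x).2.2.1) hs0 hs₂ hy₁ 0
        (by norm_num) ht ξ hξ).add (Beam.ser_hasDeriv_x hL kB kC (fun k x => (kd k x).2.2.1)
        hs0 hs₂ hy₂ 0 (by norm_num) ht ξ hξ)).congr hmom (hmom ξ hξ)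
    · intro ξ hξ
      exact (Beam.ser_hasDeriv_x hL gC gD (fun k x => (gd k x).2.2.2) hs0 hs₂ hy₁ 0
        (by norm_num) ht ξ hξ).add (Beam.ser_hasDeriv_x hL kC kD (fun k x => (kd k x).2.2.2)
        hs0 hs₂ hy₂ 0 (by norm_num) ht ξ hξ)
  rw [htt, hxxxx, Beam.ser_phiD gD hs0 hs₂ hy₁ hx ht, Beam.ser_phiD kD hs0 hs₂ hy₂ hx ht,
    hre x hx]
  ring
end

section
/- Let T > 0, s ∈ (1,2) and y_1, y_2 ∈ G_s[0,T], and define w(x,t) = Σ_{k≥0} g_k(x) y_1^{(2k)}(t) + Σ_{k≥0} h_k(x) y_2^{(2k)}(t) for (x,t) ∈ [0,L]×[0,T]. Then w satisfies the tip-mass boundary conditions m w_tt(0,t) + (EI w_xx)_x(0,t) = 0 and J w_xtt(0,t) − EI(0) w_xx(0,t) = 0 for all t ∈ [0,T]. -/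
open Set Filter intervalIntegral

/-- Bookkeeping: a sequence `f` of generating functions with `d = f'`, `q = EI f''`, `p = q'`. -/
structure BeamSeq (L : ℝ) (ρ EI : ℝ → ℝ) (f d q p : ℕ → ℝ → ℝ) : Prop where
  hf : ∀ k, ∀ x ∈ Set.Icc 0 L, f k x = f k 0 + ∫ u in (0:ℝ)..x, d k u
  hd : ∀ k x, d k x = d k 0 + ∫ u in (0:ℝ)..x, q k u / EI u
  hq : ∀ k x, q k x = q k 0 + ∫ u in (0:ℝ)..x, p k u
  hp : ∀ k x, p (k + 2) x = - ∫ u in (0:ℝ)..x, ρ u * f (k + 1) u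
  hp0 : ContinuousOn (p 0) (Set.Icc 0 L)
  hp1 : ContinuousOn (p 1) (Set.Icc 0 L)
  f0 : ∀ k, f (k + 1) 0 = 0
  d0 : ∀ k, d (k + 1) 0 = 0
  q0 : ∀ k, q (k + 2) 0 = 0
  q00 : q 0 0 = 0
  p00 : p 0 0 = 0

theorem cont_prim {L : ℝ} (hL : 0 < L) {v : ℝ → ℝ} (hv : ContinuousOn v (Set.Icc 0 L)) :
    ContinuousOn (fun x => ∫ u in (0:ℝ)..x, v u) (Set.Icc 0 L) := by
  have := intervalIntegral.continuousOn_primitive_interval (a := 0) (b := L) (f := v)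
    (μ := MeasureTheory.volume)
    (by rw [Set.uIcc_of_le hL.le]; exact hv.integrableOn_Icc)
  rwa [Set.uIcc_of_le hL.le] at this

theorem BeamSeq.cont {L : ℝ} (hL : 0 < L) {ρ EI : ℝ → ℝ} {f d q p : ℕ → ℝ → ℝ}
    (H : BeamSeq L ρ EI f d q p) (hρ : ContinuousOn ρ (Set.Icc 0 L))
    (hEI : ContinuousOn EI (Set.Icc 0 L)) (hne : ∀ x ∈ Set.Icc 0 L, EI x ≠ 0) (k : ℕ) :
    ContinuousOn (p k) (Set.Icc 0 L) ∧ ContinuousOn (q k) (Set.Icc 0 L) ∧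
    ContinuousOn (d k) (Set.Icc 0 L) ∧ ContinuousOn (f k) (Set.Icc 0 L) := by
  have step : ∀ k, ContinuousOn (p k) (Set.Icc 0 L) → ContinuousOn (p k) (Set.Icc 0 L) ∧
      ContinuousOn (q k) (Set.Icc 0 L) ∧
      ContinuousOn (d k) (Set.Icc 0 L) ∧ ContinuousOn (f k) (Set.Icc 0 L) := by
    intro k hk
    have h1 : ContinuousOn (q k) (Set.Icc 0 L) :=
      (continuousOn_const.add (cont_prim hL hk)).congr (fun x _ => H.hq k x)
    have h2 : ContinuousOn (d k) (Set.Icc 0 L) :=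
      (continuousOn_const.add (cont_prim hL (h1.div hEI hne))).congr (fun x _ => H.hd k x)
    have h3 : ContinuousOn (f k) (Set.Icc 0 L) :=
      (continuousOn_const.add (cont_prim hL h2)).congr (fun x hx => H.hf k x hx)
    exact ⟨hk, h1, h2, h3⟩
  have base : ∀ k, ContinuousOn (p (k+1)) (Set.Icc 0 L) := by
    intro k
    induction k with
    | zero => exact H.hp1
    | succ k ih =>
      exact ((cont_prim hL (hρ.mul (step _ ih).2.2.2)).neg).congr (fun x _ => H.hp k x)
  cases k with
  | zero => exact step 0 H.hp0
  | succ k => exact step _ (base k)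

theorem int_bound {L A : ℝ} {n : ℕ} {v : ℝ → ℝ}
    (hv : ∀ u ∈ Set.Icc 0 L, |v u| ≤ A * (u ^ n / n.factorial)) :
    ∀ x ∈ Set.Icc 0 L, |∫ u in (0:ℝ)..x, v u| ≤ A * (x ^ (n+1) / (n+1).factorial) := by
  intro x hx
  have := intervalIntegral.norm_integral_le_of_norm_le (μ := MeasureTheory.volume) (f := v)
    (g := fun u => A * (u ^ n / n.factorial)) hx.1
    (Filter.Eventually.of_forall fun t ht => hv t ⟨ht.1.le, ht.2.trans hx.2⟩)
    (by apply Continuous.intervalIntegrable; fun_prop)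
  rw [Real.norm_eq_abs] at this
  refine this.trans (le_of_eq ?_)
  rw [intervalIntegral.integral_const_mul, intervalIntegral.integral_div, integral_pow,
    Nat.factorial_succ]
  push_cast
  have : (n.factorial : ℝ) ≠ 0 := by positivity
  field_simp
  simp

theorem fact_shift (n : ℕ) :
    (1:ℝ) / n.factorial ≤ Nat.factorial 8 * 2 ^ (n + 8) / (n + 8).factorial := by
  have h := Nat.add_choose_mul_factorial_mul_factorial n 8
  have h2 := Nat.choose_le_two_pow (n+8) 8
  rw [div_le_div_iff₀ (by positivity) (by positivity), ← h]
  have h3 : (((n+8).choose 8 : ℕ) : ℝ) ≤ 2 ^ (n+8) := by exact_mod_cast h2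
  push_cast
  have : (0:ℝ) < n.factorial * Nat.factorial 8 := by positivity
  nlinarith

theorem BeamSeq.bound {L : ℝ} (hL : 0 < L) {ρ EI : ℝ → ℝ} {f d q p : ℕ → ℝ → ℝ}
    (H : BeamSeq L ρ EI f d q p) (hρ : ContinuousOn ρ (Set.Icc 0 L))
    (hEI : ContinuousOn EI (Set.Icc 0 L)) (hne : ∀ x ∈ Set.Icc 0 L, EI x ≠ 0) :
    ∃ C > 0, ∃ K > 0, ∀ k, ∀ x ∈ Set.Icc 0 L,
      |p k x| ≤ C * K ^ k / (4 * k).factorial ∧ |q k x| ≤ C * K ^ k / (4 * k).factorial ∧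
      |q k x / EI x| ≤ C * K ^ k / (4 * k).factorial ∧
      |d k x| ≤ C * K ^ k / (4 * k).factorial ∧ |f k x| ≤ C * K ^ k / (4 * k).factorial := by
  have bd : ∀ v : ℝ → ℝ, ContinuousOn v (Set.Icc 0 L) → ∃ B, ∀ x ∈ Set.Icc 0 L, |v x| ≤ B :=
    fun v hv => isCompact_Icc.exists_bound_of_continuousOn hv
  have hc := H.cont hL hρ hEI hne
  have bk : ∀ k, ∃ B, ∀ x ∈ Set.Icc 0 L, |p k x| ≤ B ∧ |q k x| ≤ B ∧ |q k x / EI x| ≤ B ∧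
      |d k x| ≤ B ∧ |f k x| ≤ B := by
    intro k
    obtain ⟨h1, h2, h3, h4⟩ := hc k
    obtain ⟨b1, hb1⟩ := bd _ h1
    obtain ⟨b2, hb2⟩ := bd _ h2
    obtain ⟨b3, hb3⟩ := bd _ (h2.div hEI hne)
    obtain ⟨b4, hb4⟩ := bd _ h3
    obtain ⟨b5, hb5⟩ := bd _ h4
    refine ⟨max b1 (max b2 (max b3 (max b4 b5))), fun x hx => ?_⟩
    have e1 := hb1 x hx
    have e2 := hb2 x hx
    have e3 := hb3 x hx
    have e4 := hb4 x hx
    have e5 := hb5 x hx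
    simp only [Pi.div_apply] at e3
    simp only [le_max_iff]
    tauto
  obtain ⟨B0, hB0⟩ := bk 0
  obtain ⟨B1, hB1⟩ := bk 1
  obtain ⟨R0, hR0⟩ := bd _ hρ
  obtain ⟨M0, hM0⟩ := bd _ (hEI.inv₀ hne)
  set B := max 1 (max B0 B1) with hB
  set R := max 1 R0 with hRd
  set M := max 1 M0 with hMd
  set Λ := max 1 L with hΛd
  have B_ge : 1 ≤ B := le_max_left _ _
  have R_ge : 1 ≤ R := le_max_left _ _
  have M_ge : 1 ≤ M := le_max_left _ _
  have Λ_ge : 1 ≤ Λ := le_max_left _ _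
  have hB0' : B0 ≤ B := (le_max_left _ _).trans (le_max_right _ _)
  have hB1' : B1 ≤ B := (le_max_right _ _).trans (le_max_right _ _)
  have hR : ∀ x ∈ Set.Icc 0 L, |ρ x| ≤ R := fun x hx => (hR0 x hx).trans (le_max_right _ _)
  have hM : ∀ x ∈ Set.Icc 0 L, |(EI x)⁻¹| ≤ M := fun x hx => (hM0 x hx).trans (le_max_right _ _)
  -- one step
  have step : ∀ (k n : ℕ) (A : ℝ), 0 ≤ A →
      (∀ x ∈ Set.Icc 0 L, |f (k+1) x| ≤ A * (x ^ n / n.factorial)) →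
      ∀ x ∈ Set.Icc 0 L, |p (k+2) x| ≤ (R * A) * (x ^ (n+1) / (n+1).factorial) ∧
        |q (k+2) x| ≤ (R * A) * (x ^ (n+2) / (n+2).factorial) ∧
        |q (k+2) x / EI x| ≤ (R * M * A) * (x ^ (n+2) / (n+2).factorial) ∧
        |d (k+2) x| ≤ (R * M * A) * (x ^ (n+3) / (n+3).factorial) ∧
        |f (k+2) x| ≤ (R * M * A) * (x ^ (n+4) / (n+4).factorial) := by
    intro k n A hA hfk
    have h1 : ∀ x ∈ Set.Icc 0 L, |p (k+2) x| ≤ (R * A) * (x ^ (n+1) / (n+1).factorial) := by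
      intro x hx
      rw [H.hp, abs_neg]
      refine int_bound (v := fun u => ρ u * f (k+1) u) ?_ x hx
      intro u hu
      rw [abs_mul, mul_assoc]
      exact mul_le_mul (hR u hu) (hfk u hu) (abs_nonneg _) (by linarith)
    have h2 : ∀ x ∈ Set.Icc 0 L, |q (k+2) x| ≤ (R * A) * (x ^ (n+2) / (n+2).factorial) := by
      intro x hx
      rw [H.hq, H.q0, zero_add]
      exact int_bound h1 x hx
    have h3 : ∀ x ∈ Set.Icc 0 L,
        |q (k+2) x / EI x| ≤ (R * M * A) * (x ^ (n+2) / (n+2).factorial) := by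
      intro x hx
      rw [div_eq_mul_inv, abs_mul]
      calc _ ≤ ((R * A) * (x ^ (n+2) / (n+2).factorial)) * M :=
            mul_le_mul (h2 x hx) (hM x hx) (abs_nonneg _) ((abs_nonneg _).trans (h2 x hx))
        _ = _ := by ring
    have h4 : ∀ x ∈ Set.Icc 0 L,
        |d (k+2) x| ≤ (R * M * A) * (x ^ (n+3) / (n+3).factorial) := by
      intro x hx
      rw [H.hd, H.d0, zero_add]
      exact int_bound h3 x hx
    have h5 : ∀ x ∈ Set.Icc 0 L,
        |f (k+2) x| ≤ (R * M * A) * (x ^ (n+4) / (n+4).factorial) := by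
      intro x hx
      rw [H.hf _ x hx, H.f0, zero_add]
      exact int_bound h4 x hx
    exact fun x hx => ⟨h1 x hx, h2 x hx, h3 x hx, h4 x hx, h5 x hx⟩
  have ind : ∀ k, ∀ x ∈ Set.Icc 0 L,
      |f (k+1) x| ≤ (B * (R * M) ^ k) * (x ^ (4*k) / (4*k).factorial) := by
    intro k
    induction k with
    | zero => intro x hx; simpa using ((hB1 x hx).2.2.2.2).trans hB1'
    | succ k ih =>
      intro x hx
      have := (step k (4*k) (B * (R * M) ^ k) (by positivity) ih x hx).2.2.2.2
      rw [show 4 * (k+1) = 4 * k + 4 by ring]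
      refine this.trans (le_of_eq ?_)
      ring
  have hK1 : 1 ≤ 16 * (R * M) * Λ ^ 4 := by
    have : 1 ≤ (R * M) * Λ ^ 4 :=
      one_le_mul_of_one_le_of_one_le (one_le_mul_of_one_le_of_one_le R_ge M_ge)
        (one_le_pow₀ Λ_ge)
    linarith
  refine ⟨Nat.factorial 8 * B, by positivity, 16 * (R * M) * Λ ^ 4, by positivity, ?_⟩
  set K := 16 * (R * M) * Λ ^ 4 with hK
  have fin : ∀ (k : ℕ) (x : ℝ), x ∈ Set.Icc 0 L → ∀ c : ℝ, 0 ≤ c → c ≤ R * M → ∀ j ≤ 4,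
      (c * (B * (R * M) ^ k)) * (x ^ (4*k+j) / (4*k+j).factorial)
        ≤ Nat.factorial 8 * B * K ^ (k+2) / (4 * (k+2)).factorial := by
    intro k x hx c hc0 hc j hj
    have e1 : x ^ (4*k+j) ≤ Λ ^ (4*k+4) :=
      (pow_le_pow_left₀ hx.1 (hx.2.trans (le_max_right _ _)) _).trans
        (pow_le_pow_right₀ Λ_ge (by omega))
    have e2 : ((4*k).factorial : ℝ) ≤ (4*k+j).factorial := by
      exact_mod_cast Nat.factorial_le (by omega)
    have e3 : x ^ (4*k+j) / (4*k+j).factorial ≤ Λ ^ (4*k+4) * (1 / (4*k).factorial) := by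
      rw [mul_one_div]
      exact div_le_div₀ (by positivity) e1 (by positivity) e2
    have e4 := fact_shift (4*k)
    calc (c * (B * (R * M) ^ k)) * (x ^ (4*k+j) / (4*k+j).factorial)
        ≤ ((R * M) * (B * (R * M) ^ k)) * (Λ ^ (4*k+4) *
            (Nat.factorial 8 * 2 ^ (4*k + 8) / (4*k + 8).factorial)) := by
          refine mul_le_mul (mul_le_mul_of_nonneg_right hc (by positivity))
            (e3.trans (mul_le_mul_of_nonneg_left e4 (by positivity))) ?_ (by positivity)
          have := hx.1
          positivity
      _ = (Nat.factorial 8 * B * (16 ^ (k+2) * (R * M) ^ (k+1) * (Λ ^ 4) ^ (k+1)))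
            / (4 * k + 8).factorial := by
          rw [show (16:ℝ) = 2 ^ 4 by norm_num, ← pow_mul, ← pow_mul]
          ring
      _ ≤ _ := by
          rw [show 4 * (k+2) = 4*k+8 by ring, hK, mul_pow (16 * (R * M)), mul_pow 16 (R * M)]
          have g1 : (R * M) ^ (k+1) ≤ (R * M) ^ (k+2) :=
            pow_le_pow_right₀ (one_le_mul_of_one_le_of_one_le R_ge M_ge) (by omega)
          have g2 : (Λ ^ 4) ^ (k+1) ≤ (Λ ^ 4) ^ (k+2) :=
            pow_le_pow_right₀ (one_le_pow₀ Λ_ge) (by omega)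
          gcongr
  intro k
  match k with
  | 0 =>
    intro x hx
    have hh : B0 ≤ Nat.factorial 8 * B * K ^ 0 / (4 * 0).factorial := by
      simp [Nat.factorial]; linarith
    obtain ⟨a1, a2, a3, a4, a5⟩ := hB0 x hx
    exact ⟨a1.trans hh, a2.trans hh, a3.trans hh, a4.trans hh, a5.trans hh⟩
  | 1 =>
    intro x hx
    have hh : B1 ≤ Nat.factorial 8 * B * K ^ 1 / (4 * 1).factorial := by
      simp [Nat.factorial]; nlinarith
    obtain ⟨a1, a2, a3, a4, a5⟩ := hB1 x hx
    exact ⟨a1.trans hh, a2.trans hh, a3.trans hh, a4.trans hh, a5.trans hh⟩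
  | (k+2) =>
    intro x hx
    obtain ⟨a1, a2, a3, a4, a5⟩ := step k (4*k) (B * (R * M) ^ k) (by positivity) (ind k) x hx
    have hRM : R ≤ R * M := by nlinarith
    exact ⟨a1.trans (fin k x hx _ (by positivity) hRM 1 (by omega)),
      a2.trans (fin k x hx _ (by positivity) hRM 2 (by omega)),
      a3.trans (fin k x hx _ (by positivity) le_rfl 2 (by omega)),
      a4.trans (fin k x hx _ (by positivity) le_rfl 3 (by omega)),
      a5.trans (fin k x hx _ (by positivity) le_rfl 4 (by omega))⟩

theorem summable_aux (A a : ℝ) (hA : 0 < A) (ha : 0 < a) :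
    Summable (fun k : ℕ => A ^ k / (k.factorial : ℝ) ^ a) := by
  refine summable_of_ratio_test_tendsto_lt_one (l := 0) one_pos
    (Filter.Eventually.of_forall fun k => by positivity) ?_
  have h : (fun k : ℕ => ‖A ^ (k+1) / ((k+1).factorial : ℝ) ^ a‖ / ‖A ^ k / (k.factorial : ℝ) ^ a‖)
      = fun k : ℕ => A * (((k + 1 : ℕ) : ℝ) ^ a)⁻¹ := by
    funext k
    rw [Real.norm_of_nonneg (by positivity), Real.norm_of_nonneg (by positivity),
      Nat.factorial_succ, Nat.cast_mul, Real.mul_rpow (by positivity) (by positivity)]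
    have h1 : (k.factorial : ℝ) ^ a ≠ 0 := by positivity
    have h2 : ((k + 1 : ℕ) : ℝ) ^ a ≠ 0 := by positivity
    field_simp
    ring
  rw [h]
  have h1 : Tendsto (fun k : ℕ => ((k+1 : ℕ) : ℝ) ^ a) atTop atTop :=
    (tendsto_rpow_atTop ha).comp
      (tendsto_natCast_atTop_atTop.comp (tendsto_add_atTop_nat 1))
  simpa using h1.inv_tendsto_atTop.const_mul A

theorem summable_gevrey (C K D s : ℝ) (hC : 0 < C) (hK : 0 < K) (hD : 0 < D) (hs : s < 2) :
    Summable (fun k : ℕ => (C * K ^ k / (4 * k).factorial) *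
      (D ^ (2 * k + 1) * ((2 * k).factorial : ℝ) ^ s)) := by
  have h := (summable_aux (K * D ^ 2) (2 - s) (by positivity) (by linarith)).mul_left (C * D)
  refine Summable.of_nonneg_of_le (fun k => by positivity) (fun k => ?_) h
  have h1 : ((2*k).factorial : ℝ) ^ (2:ℝ) ≤ (4*k).factorial := by
    have := Nat.le_of_dvd (Nat.factorial_pos _) (Nat.factorial_mul_factorial_dvd_factorial_add (2*k) (2*k))
    rw [show 2*k+2*k = 4*k by ring, ← sq] at this
    rw [Real.rpow_two]
    exact_mod_cast this
  have hp : (0:ℝ) < (2*k).factorial := by positivity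
  have h2 : ((2*k).factorial : ℝ) ^ s = ((2*k).factorial : ℝ) ^ (2:ℝ) / ((2*k).factorial : ℝ) ^ (2 - s) := by
    rw [← Real.rpow_sub hp]; congr 1; ring
  have h3 : (k.factorial : ℝ) ^ (2 - s) ≤ ((2*k).factorial : ℝ) ^ (2 - s) :=
    Real.rpow_le_rpow (by positivity) (by exact_mod_cast Nat.factorial_le (by omega)) (by linarith)
  have h4 : ((2*k).factorial : ℝ) ^ s ≤ (4*k).factorial / (k.factorial : ℝ) ^ (2-s) := by
    rw [h2]
    exact div_le_div₀ (by positivity) h1 (by positivity) h3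
  calc _ ≤ (C * K ^ k / (4 * k).factorial) *
      (D ^ (2 * k + 1) * ((4*k).factorial / (k.factorial : ℝ) ^ (2-s))) := by gcongr
    _ = _ := by
      have : ((4*k).factorial : ℝ) ≠ 0 := by positivity
      field_simp
      ring

theorem series_deriv {L : ℝ} (hL : 0 < L) {F F' : ℕ → ℝ → ℝ} {u : ℕ → ℝ} (hu : Summable u)
    (hc : ∀ k, ContinuousOn (F' k) (Set.Icc 0 L))
    (hb : ∀ k, ∀ x ∈ Set.Icc 0 L, |F' k x| ≤ u k)
    (hF : ∀ k, ∀ x ∈ Set.Icc 0 L, F k x = F k 0 + ∫ t in (0:ℝ)..x, F' k t)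
    (h0 : Summable fun k => F k 0) :
    ∀ x ∈ Set.Icc 0 L,
      HasDerivWithinAt (fun x => ∑' k, F k x) (∑' k, F' k x) (Set.Icc 0 L) x := by
  intro x hx
  let G' : ℕ → ℝ → ℝ := fun k => Set.IccExtend hL.le ((Set.Icc 0 L).domRestrict (F' k))
  have G'c : ∀ k, Continuous (G' k) := fun k => (hc k).domRestrict.Icc_extend'
  have G'e : ∀ k, ∀ x ∈ Set.Icc 0 L, G' k x = F' k x := fun k x hx => by
    simp [G', Set.IccExtend_of_mem _ _ hx, Set.domRestrict]
  have G'b : ∀ k x, ‖G' k x‖ ≤ u k := fun k x => hb k _ (Set.projIcc 0 L hL.le x).2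
  have Fe : ∀ k, ∀ x ∈ Set.Icc 0 L, F k 0 + ∫ t in (0:ℝ)..x, G' k t = F k x := by
    intro k x hx
    rw [hF k x hx]
    congr 1
    apply intervalIntegral.integral_congr
    intro t ht
    rw [Set.uIcc_of_le hx.1] at ht
    exact G'e k t ⟨ht.1, ht.2.trans hx.2⟩
  have key := hasDerivAt_tsum (g := fun k x => F k 0 + ∫ t in (0:ℝ)..x, G' k t) (g' := G')
    (y₀ := 0) hu (fun k y => ((G'c k).integral_hasStrictDerivAt 0 y).hasDerivAt.const_add _)
    G'b (by simpa using h0) x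
  have e : ∑' k, G' k x = ∑' k, F' k x := tsum_congr fun k => G'e k x hx
  rw [e] at key
  exact key.hasDerivWithinAt.congr (fun y hy => tsum_congr fun k => (Fe k y hy).symm)
    (tsum_congr fun k => (Fe k x hx).symm)

theorem ii_of_cont {L x : ℝ} {v : ℝ → ℝ} (hv : ContinuousOn v (Set.Icc 0 L))
    (hx : x ∈ Set.Icc 0 L) : IntervalIntegrable v MeasureTheory.volume 0 x := by
  apply ContinuousOn.intervalIntegrable
  rw [Set.uIcc_of_le hx.1]
  exact hv.mono (Set.Icc_subset_Icc le_rfl hx.2)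

theorem dbl_add {L : ℝ} (hL : 0 < L) {a b : ℝ → ℝ} (ha : ContinuousOn a (Set.Icc 0 L))
    (hb : ContinuousOn b (Set.Icc 0 L)) {x : ℝ} (hx : x ∈ Set.Icc 0 L) :
    (∫ s₁ in (0:ℝ)..x, ∫ s₂ in (0:ℝ)..s₁, (a s₂ + b s₂)) =
      (∫ s₁ in (0:ℝ)..x, ∫ s₂ in (0:ℝ)..s₁, a s₂) +
      ∫ s₁ in (0:ℝ)..x, ∫ s₂ in (0:ℝ)..s₁, b s₂ := by
  rw [← intervalIntegral.integral_add (ii_of_cont (cont_prim hL ha) hx)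
    (ii_of_cont (cont_prim hL hb) hx)]
  apply intervalIntegral.integral_congr
  intro y hy
  rw [Set.uIcc_of_le hx.1] at hy
  have hy' : y ∈ Set.Icc 0 L := ⟨hy.1, hy.2.trans hx.2⟩
  exact intervalIntegral.integral_add (ii_of_cont ha hy') (ii_of_cont hb hy')

theorem first_form {L : ℝ} (hL : 0 < L) {r EI : ℝ → ℝ} (hr : ContinuousOn r (Set.Icc 0 L))
    (hEI : ContinuousOn EI (Set.Icc 0 L)) (hne : ∀ x ∈ Set.Icc 0 L, EI x ≠ 0) (α β : ℝ)
    {x : ℝ} (hx : x ∈ Set.Icc 0 L) :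
    (∫ s₁ in (0:ℝ)..x, ∫ s₂ in (0:ℝ)..s₁,
      (α + ∫ s₃ in (0:ℝ)..s₂, (-(∫ s₄ in (0:ℝ)..s₃, r s₄) + β)) / EI s₂) =
    -(∫ s₁ in (0:ℝ)..x, ∫ s₂ in (0:ℝ)..s₁, ∫ s₃ in (0:ℝ)..s₂, ∫ s₄ in (0:ℝ)..s₃, r s₄ / EI s₂)
    + β * (∫ s₁ in (0:ℝ)..x, ∫ s₂ in (0:ℝ)..s₁, ∫ _s₃ in (0:ℝ)..s₂, 1 / EI s₂)
    + α * ∫ s₁ in (0:ℝ)..x, ∫ s₂ in (0:ℝ)..s₁, 1 / EI s₂ := by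
  have c1 : ContinuousOn (fun y => (-(∫ s₃ in (0:ℝ)..y, ∫ s₄ in (0:ℝ)..s₃, r s₄)) / EI y)
      (Set.Icc 0 L) := (cont_prim hL (cont_prim hL hr)).neg.div hEI hne
  have c2 : ContinuousOn (fun y => β * (y * (1 / EI y))) (Set.Icc 0 L) :=
    continuousOn_const.mul (continuousOn_id.mul (continuousOn_const.div hEI hne))
  have c3 : ContinuousOn (fun y => α * (1 / EI y)) (Set.Icc 0 L) :=
    continuousOn_const.mul (continuousOn_const.div hEI hne)
  have e : (∫ s₁ in (0:ℝ)..x, ∫ s₂ in (0:ℝ)..s₁,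
      (α + ∫ s₃ in (0:ℝ)..s₂, (-(∫ s₄ in (0:ℝ)..s₃, r s₄) + β)) / EI s₂) =
      ∫ s₁ in (0:ℝ)..x, ∫ s₂ in (0:ℝ)..s₁,
        (((-(∫ s₃ in (0:ℝ)..s₂, ∫ s₄ in (0:ℝ)..s₃, r s₄)) / EI s₂ + β * (s₂ * (1 / EI s₂)))
          + α * (1 / EI s₂)) := by
    apply intervalIntegral.integral_congr
    intro y hy
    rw [Set.uIcc_of_le hx.1] at hy
    apply intervalIntegral.integral_congr
    intro z hz
    rw [Set.uIcc_of_le hy.1] at hz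
    have hz' : z ∈ Set.Icc 0 L := ⟨hz.1, hz.2.trans (hy.2.trans hx.2)⟩
    have := intervalIntegral.integral_add (ii_of_cont (cont_prim hL hr).neg hz')
      (intervalIntegrable_const (μ := MeasureTheory.volume) (c := β) (a := 0) (b := z))
    simp only [Pi.neg_apply, intervalIntegral.integral_neg, intervalIntegral.integral_const] at this
    simp only [this]
    simp only [smul_eq_mul]
    ring
  have c12 : ContinuousOn (fun y => (-(∫ s₃ in (0:ℝ)..y, ∫ s₄ in (0:ℝ)..s₃, r s₄)) / EI y
      + β * (y * (1 / EI y))) (Set.Icc 0 L) := c1.add c2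
  rw [e, dbl_add hL c12 c3 hx, dbl_add hL c1 c2 hx]
  simp only [intervalIntegral.integral_const_mul, intervalIntegral.integral_const,
    intervalIntegral.integral_div, intervalIntegral.integral_neg, neg_div, smul_eq_mul, sub_zero]
  simp only [mul_one_div, mul_one]

/-- third derivative data for `genG` -/
noncomputable def pG (ρ EI : ℝ → ℝ) (m : ℝ) : ℕ → ℝ → ℝ
  | 0 => fun _ => 0
  | 1 => fun x => -(∫ u in (0:ℝ)..x, ρ u) + (-m)
  | (k + 2) => fun x => -∫ u in (0:ℝ)..x, ρ u * genG ρ EI m (k + 1) u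

noncomputable def qG (ρ EI : ℝ → ℝ) (m : ℝ) : ℕ → ℝ → ℝ :=
  fun k x => ∫ u in (0:ℝ)..x, pG ρ EI m k u

noncomputable def dG (ρ EI : ℝ → ℝ) (m : ℝ) : ℕ → ℝ → ℝ :=
  fun k x => ∫ u in (0:ℝ)..x, qG ρ EI m k u / EI u

noncomputable def pH (ρ EI : ℝ → ℝ) (J : ℝ) : ℕ → ℝ → ℝ
  | 0 => fun _ => 0
  | 1 => fun x => -(∫ u in (0:ℝ)..x, u * ρ u) + 0
  | (k + 2) => fun x => -∫ u in (0:ℝ)..x, ρ u * genH ρ EI J (k + 1) u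

noncomputable def qH (ρ EI : ℝ → ℝ) (J : ℝ) : ℕ → ℝ → ℝ :=
  fun k x => (if k = 1 then J else 0) + ∫ u in (0:ℝ)..x, pH ρ EI J k u

noncomputable def dH (ρ EI : ℝ → ℝ) (J : ℝ) : ℕ → ℝ → ℝ :=
  fun k x => (if k = 0 then 1 else 0) + ∫ u in (0:ℝ)..x, qH ρ EI J k u / EI u

theorem beamG {L : ℝ} (hL : 0 < L) {ρ EI : ℝ → ℝ} (hρ : ContinuousOn ρ (Set.Icc 0 L))
    (hEI : ContinuousOn EI (Set.Icc 0 L)) (hne : ∀ x ∈ Set.Icc 0 L, EI x ≠ 0) (m : ℝ) :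
    BeamSeq L ρ EI (genG ρ EI m) (dG ρ EI m) (qG ρ EI m) (pG ρ EI m) where
  hf := by
    intro k x hx
    match k with
    | 0 => simp [genG, dG, qG, pG]
    | 1 =>
      have := first_form hL hρ hEI hne 0 (-m) hx
      simp only [genG, dG, qG, pG, intervalIntegral.integral_same, zero_add] at this ⊢
      rw [this]; ring
    | (k+2) =>
      simp only [genG, dG, qG, pG, intervalIntegral.integral_same, zero_add,
        intervalIntegral.integral_div, intervalIntegral.integral_neg, neg_div, neg_zero]
  hd := by intro k x; simp [dG]
  hq := by intro k x; simp [qG]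
  hp := by intro k x; simp [pG]
  hp0 := by simp only [pG]; exact continuousOn_const
  hp1 := (cont_prim hL hρ).neg.add continuousOn_const
  f0 := by intro k; cases k <;> simp [genG]
  d0 := by intro k; simp [dG]
  q0 := by intro k; simp [qG]
  q00 := by simp [qG]
  p00 := by simp [pG]

theorem beamH {L : ℝ} (hL : 0 < L) {ρ EI : ℝ → ℝ} (hρ : ContinuousOn ρ (Set.Icc 0 L))
    (hEI : ContinuousOn EI (Set.Icc 0 L)) (hne : ∀ x ∈ Set.Icc 0 L, EI x ≠ 0) (J : ℝ) :
    BeamSeq L ρ EI (genH ρ EI J) (dH ρ EI J) (qH ρ EI J) (pH ρ EI J) where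
  hf := by
    intro k x hx
    match k with
    | 0 => simp [genH, dH, qH, pH]
    | 1 =>
      have := first_form hL (continuousOn_id.mul hρ) hEI hne J 0 hx
      simp only [Pi.mul_apply, id] at this
      simp only [genH, dH, qH, pH, intervalIntegral.integral_same, one_ne_zero, if_true, if_false,
        zero_add]
      rw [this]; ring
    | (k+2) =>
      have h1 : k + 2 ≠ 1 := by omega
      have h2 : k + 2 ≠ 0 := by omega
      simp only [genH, dH, qH, pH, intervalIntegral.integral_same, zero_add, h1, h2, if_false,
        intervalIntegral.integral_div, intervalIntegral.integral_neg, neg_div, neg_zero]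
  hd := by intro k x; simp [dH]
  hq := by intro k x; simp [qH]
  hp := by intro k x; simp [pH]
  hp0 := by simp only [pH]; exact continuousOn_const
  hp1 := (cont_prim hL (continuousOn_id.mul hρ)).neg.add continuousOn_const
  f0 := by intro k; cases k <;> simp [genH]
  d0 := by intro k; simp [dH]
  q0 := by intro k; simp [qH]
  q00 := by simp [qH]
  p00 := by simp [pH]

theorem comb {L : ℝ} {f f' h h' : ℝ → ℝ} (hf' : ContinuousOn f' (Set.Icc 0 L))
    (hh' : ContinuousOn h' (Set.Icc 0 L)) (a b : ℝ) {x : ℝ} (hx : x ∈ Set.Icc 0 L)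
    (hf : f x = f 0 + ∫ u in (0:ℝ)..x, f' u) (hh : h x = h 0 + ∫ u in (0:ℝ)..x, h' u) :
    f x * a + h x * b = (f 0 * a + h 0 * b) + ∫ u in (0:ℝ)..x, (f' u * a + h' u * b) := by
  have c1 : ContinuousOn (fun u => f' u * a) (Set.Icc 0 L) := hf'.mul continuousOn_const
  have c2 : ContinuousOn (fun u => h' u * b) (Set.Icc 0 L) := hh'.mul continuousOn_const
  rw [intervalIntegral.integral_add (ii_of_cont c1 hx) (ii_of_cont c2 hx),
    intervalIntegral.integral_mul_const,
    intervalIntegral.integral_mul_const, hf, hh]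
  ring

theorem core {L : ℝ} (hL : 0 < L) {ρ EI : ℝ → ℝ} (hρ : ContinuousOn ρ (Set.Icc 0 L))
    (hEI : ContinuousOn EI (Set.Icc 0 L)) (hne : ∀ x ∈ Set.Icc 0 L, EI x ≠ 0)
    {f d q p f₂ d₂ q₂ p₂ : ℕ → ℝ → ℝ}
    (H : BeamSeq L ρ EI f d q p) (H₂ : BeamSeq L ρ EI f₂ d₂ q₂ p₂)
    {T s : ℝ} (hs : s < 2) {y₁ y₂ : ℝ → ℝ} (hy₁ : MemGevrey s T y₁) (hy₂ : MemGevrey s T y₂)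
    {t : ℝ} (ht : t ∈ Set.Icc 0 T) (a b : ℕ → ℝ) (ha : a = fun k => iteratedDeriv (2 * k) y₁ t)
    (hb : b = fun k => iteratedDeriv (2 * k) y₂ t) :
    (∀ x ∈ Set.Icc 0 L, HasDerivWithinAt (fun x => ∑' k, (f k x * a k + f₂ k x * b k))
      (∑' k, (d k x * a k + d₂ k x * b k)) (Set.Icc 0 L) x) ∧
    (∀ x ∈ Set.Icc 0 L, HasDerivWithinAt (fun x => ∑' k, (d k x * a k + d₂ k x * b k))
      (∑' k, (q k x / EI x * a k + q₂ k x / EI x * b k)) (Set.Icc 0 L) x) ∧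
    (∀ x ∈ Set.Icc 0 L, HasDerivWithinAt (fun x => ∑' k, (q k x * a k + q₂ k x * b k))
      (∑' k, (p k x * a k + p₂ k x * b k)) (Set.Icc 0 L) x) := by
  obtain ⟨C, hC, K, hK, B⟩ := H.bound hL hρ hEI hne
  obtain ⟨C₂, hC₂, K₂, hK₂, B₂⟩ := H₂.bound hL hρ hEI hne
  have cc := H.cont hL hρ hEI hne
  have cc₂ := H₂.cont hL hρ hEI hne
  obtain ⟨_, D, hD, hDb⟩ := hy₁
  obtain ⟨_, D₂, hD₂, hDb₂⟩ := hy₂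
  have hu := (summable_gevrey C K D s hC hK hD hs).add
    (summable_gevrey C₂ K₂ D₂ s hC₂ hK₂ hD₂ hs)
  have bnd : ∀ (k : ℕ) (v v₂ : ℝ), |v| ≤ C * K ^ k / (4 * k).factorial →
      |v₂| ≤ C₂ * K₂ ^ k / (4 * k).factorial → |v * a k + v₂ * b k| ≤
      C * K ^ k / (4 * k).factorial * (D ^ (2 * k + 1) * ((2 * k).factorial : ℝ) ^ s) +
      C₂ * K₂ ^ k / (4 * k).factorial * (D₂ ^ (2 * k + 1) * ((2 * k).factorial : ℝ) ^ s) := by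
    intro k v v₂ hv hv₂
    refine (abs_add_le _ _).trans ?_
    rw [abs_mul, abs_mul]
    refine add_le_add (mul_le_mul hv ?_ (abs_nonneg _) (by positivity))
      (mul_le_mul hv₂ ?_ (abs_nonneg _) (by positivity))
    · rw [ha]; exact hDb (2 * k) t ht
    · rw [hb]; exact hDb₂ (2 * k) t ht
  have z : (0:ℝ) ∈ Set.Icc 0 L := ⟨le_rfl, hL.le⟩
  refine ⟨?_, ?_, ?_⟩
  · refine series_deriv hL hu (fun k => ((cc k).2.2.1.mul continuousOn_const).add
        ((cc₂ k).2.2.1.mul continuousOn_const))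
      (fun k x hx => bnd k _ _ (B k x hx).2.2.2.1 (B₂ k x hx).2.2.2.1)
      (fun k x hx => comb (f := f k) (h := f₂ k) (cc k).2.2.1 (cc₂ k).2.2.1 _ _ hx
        (H.hf k x hx) (H₂.hf k x hx))
      (Summable.of_norm_bounded hu
        (fun k => bnd k _ _ (B k 0 z).2.2.2.2 (B₂ k 0 z).2.2.2.2))
  · refine series_deriv hL hu (fun k => (((cc k).2.1.div hEI hne).mul continuousOn_const).add
        (((cc₂ k).2.1.div hEI hne).mul continuousOn_const))
      (fun k x hx => bnd k _ _ (B k x hx).2.2.1 (B₂ k x hx).2.2.1)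
      (fun k x hx => comb (f := d k) (h := d₂ k) ((cc k).2.1.div hEI hne)
        ((cc₂ k).2.1.div hEI hne) _ _ hx (H.hd k x) (H₂.hd k x))
      (Summable.of_norm_bounded hu
        (fun k => bnd k _ _ (B k 0 z).2.2.2.1 (B₂ k 0 z).2.2.2.1))
  · refine series_deriv hL hu (fun k => ((cc k).1.mul continuousOn_const).add
        ((cc₂ k).1.mul continuousOn_const))
      (fun k x hx => bnd k _ _ (B k x hx).1 (B₂ k x hx).1)
      (fun k x hx => comb (f := q k) (h := q₂ k) (cc k).1 (cc₂ k).1 _ _ hx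
        (H.hq k x) (H₂.hq k x))
      (Summable.of_norm_bounded hu
        (fun k => bnd k _ _ (B k 0 z).2.1 (B₂ k 0 z).2.1))

/-- `w` satisfies the tip-mass boundary conditions
`m w_tt(0,t) + (EI w_xx)_x(0,t) = 0` and `J w_xtt(0,t) - EI(0) w_xx(0,t) = 0`
for all `t ∈ [0,T]`. -/
theorem stmt8 (L m J : ℝ) (hL : 0 < L) (hm : 0 < m) (hJ : 0 < J)
    (ρ EI : ℝ → ℝ)
    (hρ : ContDiffOn ℝ 4 ρ (Set.Icc 0 L)) (hEI : ContDiffOn ℝ 4 EI (Set.Icc 0 L))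
    (hρpos : ∃ c > 0, ∀ x ∈ Set.Icc (0:ℝ) L, c ≤ ρ x)
    (hEIpos : ∃ c > 0, ∀ x ∈ Set.Icc (0:ℝ) L, c ≤ EI x)
    (T s : ℝ) (hT : 0 < T) (hs₁ : 1 < s) (hs₂ : s < 2)
    (y₁ y₂ : ℝ → ℝ) (hy₁ : MemGevrey s T y₁) (hy₂ : MemGevrey s T y₂)
    (w : ℝ → ℝ → ℝ) (hw : w = wSol (genG ρ EI m) (genH ρ EI J) y₁ y₂) :
    ∀ t ∈ Set.Icc (0:ℝ) T,
      m * iteratedDerivWithin 2 (fun τ => w 0 τ) (Set.Icc 0 T) t +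
        derivWithin
          (fun ξ => EI ξ * iteratedDerivWithin 2 (fun ξ' => w ξ' t) (Set.Icc 0 L) ξ)
          (Set.Icc 0 L) 0 = 0 ∧
      J * iteratedDerivWithin 2
          (fun τ => derivWithin (fun ξ => w ξ τ) (Set.Icc 0 L) 0) (Set.Icc 0 T) t -
        EI 0 * iteratedDerivWithin 2 (fun ξ' => w ξ' t) (Set.Icc 0 L) 0 = 0 := by
  have hρc := hρ.continuousOn
  have hEIc := hEI.continuousOn
  obtain ⟨c, hc, hcE⟩ := hEIpos
  have hne : ∀ x ∈ Set.Icc 0 L, EI x ≠ 0 := fun x hx => (hc.trans_le (hcE x hx)).ne'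
  have HG := beamG hL hρc hEIc hne m
  have HH := beamH hL hρc hEIc hne J
  have zL : (0:ℝ) ∈ Set.Icc 0 L := ⟨le_rfl, hL.le⟩
  have uL : UniqueDiffOn ℝ (Set.Icc 0 L) := uniqueDiffOn_Icc hL
  have uT : UniqueDiffOn ℝ (Set.Icc 0 T) := uniqueDiffOn_Icc hT
  have K := fun t (ht : t ∈ Set.Icc 0 T) =>
    core hL hρc hEIc hne HG HH hs₂ hy₁ hy₂ ht _ _ rfl rfl
  -- values at the tip
  have w0 : ∀ τ, w 0 τ = y₁ τ := by
    intro τ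
    rw [hw]
    unfold wSol
    rw [tsum_eq_single 0]
    · simp [genG, genH]
    · intro k hk
      obtain ⟨j, rfl⟩ := Nat.exists_eq_succ_of_ne_zero hk
      simp [HG.f0, HH.f0]
  have wx0 : ∀ τ ∈ Set.Icc 0 T, derivWithin (fun ξ => w ξ τ) (Set.Icc 0 L) 0 = y₂ τ := by
    intro τ hτ
    rw [hw]
    refine ((K τ hτ).1 0 zL).derivWithin (uL 0 zL) |>.trans ?_
    rw [tsum_eq_single 0]
    · simp [dG, dH]
    · intro k hk
      obtain ⟨j, rfl⟩ := Nat.exists_eq_succ_of_ne_zero hk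
      simp [HG.d0, HH.d0]
  intro t ht
  obtain ⟨K1, K2, K3⟩ := K t ht
  have dd : ∀ y : ℝ → ℝ, ContDiff ℝ (⊤ : ℕ∞) y →
      iteratedDerivWithin 2 y (Set.Icc 0 T) t = iteratedDeriv 2 y t := by
    intro y hy
    refine iteratedDerivWithin_eq_iteratedDeriv uT ?_ ht
    exact (contDiff_infty.mp hy 2).contDiffAt
  have wtt : iteratedDerivWithin 2 (fun τ => w 0 τ) (Set.Icc 0 T) t = iteratedDeriv 2 y₁ t := by
    rw [show (fun τ => w 0 τ) = y₁ from funext w0, dd y₁ hy₁.1]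
  have wxtt : iteratedDerivWithin 2
      (fun τ => derivWithin (fun ξ => w ξ τ) (Set.Icc 0 L) 0) (Set.Icc 0 T) t
      = iteratedDeriv 2 y₂ t := by
    rw [iteratedDerivWithin_congr (g := y₂) (fun τ hτ => wx0 τ hτ) ht, dd y₂ hy₂.1]
  have wxx : ∀ x ∈ Set.Icc 0 L, EI x * iteratedDerivWithin 2 (fun ξ' => w ξ' t) (Set.Icc 0 L) x
      = ∑' k, (qG ρ EI m k x * iteratedDeriv (2 * k) y₁ t
        + qH ρ EI J k x * iteratedDeriv (2 * k) y₂ t) := by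
    intro x hx
    have e : iteratedDerivWithin 2 (fun ξ' => w ξ' t) (Set.Icc 0 L) x =
        ∑' k, (qG ρ EI m k x / EI x * iteratedDeriv (2 * k) y₁ t
        + qH ρ EI J k x / EI x * iteratedDeriv (2 * k) y₂ t) := by
      rw [iteratedDerivWithin_succ, iteratedDerivWithin_one]
      refine (derivWithin_congr (fun y hy => ?_) ?_).trans ((K2 x hx).derivWithin (uL x hx))
      · rw [hw]; exact (K1 y hy).derivWithin (uL y hy)
      · rw [hw]; exact (K1 x hx).derivWithin (uL x hx)
    rw [e, ← tsum_mul_left]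
    refine tsum_congr fun k => ?_
    have := hne x hx
    field_simp
  rw [wtt, wxtt, wxx 0 zL]
  have third : derivWithin
          (fun ξ => EI ξ * iteratedDerivWithin 2 (fun ξ' => w ξ' t) (Set.Icc 0 L) ξ)
          (Set.Icc 0 L) 0 = -m * iteratedDeriv 2 y₁ t := by
    refine (derivWithin_congr wxx (wxx 0 zL)).trans ?_
    refine ((K3 0 zL).derivWithin (uL 0 zL)).trans ?_
    rw [tsum_eq_single 1]
    · simp [pG, pH]
    · intro k hk
      match k with
      | 0 => simp [pG, pH]
      | 1 => exact absurd rfl hk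
      | (k+2) => simp [pG, pH]
  have qs : ∑' k, (qG ρ EI m k 0 * iteratedDeriv (2 * k) y₁ t
        + qH ρ EI J k 0 * iteratedDeriv (2 * k) y₂ t) = J * iteratedDeriv 2 y₂ t := by
    rw [tsum_eq_single 1]
    · simp [qG, qH]
    · intro k hk
      simp [qG, qH, hk]
  rw [third, qs]
  constructor <;> ring
end
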